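/- arXiv:1808.01985 — 2 statements merged into one kernel-verified Lean document; each statement's English description precedes it below -/
import Mathlib

section
/- Multilinear Rubio de Francia weight construction: Let 1/r_1,…,1/r_{m+1} ∈ (0,1] and 1/p_1,…,1/p_{m+1} ∈ [0,1] with 1/p_j < 1/r_j for all j ∈ {1,…,m+1} and Σ_{j=1}^{m+1} 1/p_j = 1. Let w_1,…,w_{m+1} be weights with ∏_{j=1}^{m+1} w_j = 1 and [(w_1,…,w_{m+1})]_{(p_1,…,p_{m+1}),((r_1,…,r_{m+1}),∞)} < ∞. Suppose f_j ∈ L^{p_j}(w_j^{p_j}) are given, and 1/q_1,…,1/q_{m+1} ∈ [0,1] satisfy 1/q_j ≤ 1/r_j and Σ_{j=1}^{m+1} 1/q_j = 1. Then there exist weights W_1,…,W_{m+1} with ∏_{j=1}^{m+1} W_j = 1 such that (1) ∏_{j=1}^{m+1} ‖f_j‖_{L^{q_j}(W_j^{q_j})} ≤ 2^{m²} ∏_{j=1}^{m+1} ‖f_j‖_{L^{p_j}(w_j^{p_j})}, and (2) [(W_1,…,W_{m+1})]_{(q_1,…,q_{m+1}),((r_1,…,r_{m+1}),∞)} ≤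 C_{p⃗,q⃗,r⃗} · [(w_1,…,w_{m+1})]_{(p_1,…,p_{m+1}),((r_1,…,r_{m+1}),∞)}^{ max_{j=1,…,m+1} (1/r_j−1/q_j)/(1/r_j−1/p_j) }, where C_{p⃗,q⃗,r⃗} depends only on the exponents and the dimension. -/
open MeasureTheory ENNReal

noncomputable section

namespace Paper

/-- An axis-parallel (half-open) cube in `ℝⁿ` with positive side length. -/
def IsCube {n : ℕ} (Q : Set (Fin n → ℝ)) : Prop :=
  ∃ (c : Fin n → ℝ) (h : ℝ), 0 < h ∧
    Q = Set.univ.pi fun i => Set.Ico (c i) (c i + h)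

/-- A weight on `ℝⁿ`: a measurable, everywhere positive function. -/
def IsWeight {n : ℕ} (w : (Fin n → ℝ) → ℝ) : Prop :=
  Measurable w ∧ ∀ x, 0 < w x

/-- `expOf ρ` is the exponent `1/ρ ∈ (0,∞]`; `ρ = 0` encodes the exponent `∞`. -/
def expOf (ρ : ℝ) : ℝ≥0∞ := if ρ = 0 then ∞ else ENNReal.ofReal (1 / ρ)

/-- The average `⟨f⟩_{1/τ, Q}` of a real-valued `f` over `Q`;
`τ = 0` encodes the essential supremum `⟨f⟩_{∞,Q}`. -/
def avg {n : ℕ} (τ : ℝ) (f : (Fin n → ℝ) → ℝ) (Q : Set (Fin n → ℝ)) : ℝ≥0∞ :=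
  if τ = 0 then essSup (fun x => ENNReal.ofReal |f x|) (volume.restrict Q)
  else ((volume Q)⁻¹ * ∫⁻ x in Q, ENNReal.ofReal |f x| ^ (1 / τ)) ^ τ

/-- The average `⟨g⟩_{1/τ, Q}` of an `ℝ≥0∞`-valued `g` over `Q`. -/
def avgE {n : ℕ} (τ : ℝ) (g : (Fin n → ℝ) → ℝ≥0∞) (Q : Set (Fin n → ℝ)) : ℝ≥0∞ :=
  if τ = 0 then essSup g (volume.restrict Q)
  else ((volume Q)⁻¹ * ∫⁻ x in Q, g x ^ (1 / τ)) ^ τ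

/-- The weighted norm `‖f‖_{L^{1/ρ}(w^{1/ρ})} = ‖f·w‖_{L^{1/ρ}(ℝⁿ)}`;
`ρ = 0` encodes `p = ∞`. -/
def wnorm {n : ℕ} (ρ : ℝ) (f w : (Fin n → ℝ) → ℝ) : ℝ≥0∞ :=
  eLpNorm (fun x => f x * w x) (expOf ρ) volume

/-- The weighted norm `‖g·w‖_{L^{1/ρ}}` of an `ℝ≥0∞`-valued function `g`. -/
def wnormE {n : ℕ} (ρ : ℝ) (g : (Fin n → ℝ) → ℝ≥0∞) (w : (Fin n → ℝ) → ℝ) : ℝ≥0∞ :=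
  if ρ = 0 then essSup (fun x => g x * ENNReal.ofReal (w x)) volume
  else (∫⁻ x, (g x * ENNReal.ofReal (w x)) ^ (1 / ρ)) ^ ρ

/-- The weak weighted norm `‖f‖_{L^{1/ρ,∞}(w^{1/ρ})}
  = sup_{t>0} t · (∫_{|f|>t} w^{1/ρ})^{ρ}`; `ρ = 0` encodes `p = ∞`. -/
def wWeakNorm {n : ℕ} (ρ : ℝ) (f w : (Fin n → ℝ) → ℝ) : ℝ≥0∞ :=
  if ρ = 0 then wnorm 0 f w
  else ⨆ t : Set.Ioi (0 : ℝ),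
    ENNReal.ofReal t.1 *
      (∫⁻ x in {x | t.1 < |f x|}, ENNReal.ofReal (w x) ^ (1 / ρ)) ^ ρ

/-- The weak weighted norm of an `ℝ≥0∞`-valued function. -/
def wWeakNormE {n : ℕ} (ρ : ℝ) (g : (Fin n → ℝ) → ℝ≥0∞) (w : (Fin n → ℝ) → ℝ) : ℝ≥0∞ :=
  if ρ = 0 then essSup (fun x => g x * ENNReal.ofReal (w x)) volume
  else ⨆ t : Set.Ioi (0 : ℝ),
    ENNReal.ofReal t.1 *
      (∫⁻ x in {x | ENNReal.ofReal t.1 < g x}, ENNReal.ofReal (w x) ^ (1 / ρ)) ^ ρ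

/-- The weak `L¹(ℝⁿ)` quasinorm (with respect to Lebesgue measure) of an
`ℝ≥0∞`-valued function. -/
def weakL1 {n : ℕ} (g : (Fin n → ℝ) → ℝ≥0∞) : ℝ≥0∞ :=
  ⨆ t : Set.Ioi (0 : ℝ), ENNReal.ofReal t.1 * volume {x | ENNReal.ofReal t.1 < g x}

/-- The limited range multilinear weight constant `[w⃗]_{p⃗,(r⃗,s)}`, written in terms
of the reciprocal exponents `rinv j = 1/r_j`, `pinv j = 1/p_j` and `sinv = 1/s`. -/
def wConst {n m : ℕ} (rinv pinv : Fin m → ℝ) (sinv : ℝ)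
    (w : Fin m → (Fin n → ℝ) → ℝ) : ℝ≥0∞ :=
  ⨆ Q : {Q : Set (Fin n → ℝ) // IsCube Q},
    (∏ j, avg (rinv j - pinv j) (fun x => (w j x)⁻¹) Q.1) *
      avg ((∑ j, pinv j) - sinv) (fun x => ∏ j, w j x) Q.1

/-- The symmetric weight constant `[w⃗]_{p⃗,(r⃗,∞)} = sup_Q ∏_j ⟨w_j⁻¹⟩_{1/(1/r_j - 1/p_j),Q}`
for tuples of weights with `∏_j w_j = 1`. -/
def wConstS {n m : ℕ} (rinv pinv : Fin m → ℝ)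
    (w : Fin m → (Fin n → ℝ) → ℝ) : ℝ≥0∞ :=
  ⨆ Q : {Q : Set (Fin n → ℝ) // IsCube Q},
    ∏ j, avg (rinv j - pinv j) (fun x => (w j x)⁻¹) Q.1

/-- The multisublinear Hardy-Littlewood maximal operator
`M_{(r_1,…,r_m)}(f⃗)(x) = sup_{Q ∋ x} ∏_j ⟨f_j⟩_{r_j,Q}` (reciprocal exponents). -/
def maximal {n m : ℕ} (rinv : Fin m → ℝ)
    (f : Fin m → (Fin n → ℝ) → ℝ) (x : Fin n → ℝ) : ℝ≥0∞ :=
  ⨆ Q : {Q : Set (Fin n → ℝ) // IsCube Q ∧ x ∈ Q}, ∏ j, avg (rinv j) (f j) Q.1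

/-- A sparse family of cubes (with sparsity constant 2): to each cube `Q` of the family
is associated a major subset `E Q ⊆ Q` with `|Q| ≤ 2|E Q|`, and these sets are
pairwise disjoint. -/
structure SparseFamily (n : ℕ) where
  cubes : Set (Set (Fin n → ℝ))
  E : Set (Fin n → ℝ) → Set (Fin n → ℝ)
  isCube : ∀ Q ∈ cubes, IsCube Q
  E_subset : ∀ Q ∈ cubes, E Q ⊆ Q
  E_meas : ∀ Q ∈ cubes, MeasurableSet (E Q)
  E_disj : ∀ Q ∈ cubes, ∀ Q' ∈ cubes, Q ≠ Q' → Disjoint (E Q) (E Q')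
  density : ∀ Q ∈ cubes, volume Q ≤ 2 * volume (E Q)

/-- The sparse form `Λ_{r⃗,S}(f⃗) = ∑_{Q∈S} (∏_j ⟨f_j⟩_{r_j,Q}) |Q|`. -/
def sparseForm {n m : ℕ} (rinv : Fin m → ℝ) (S : SparseFamily n)
    (f : Fin m → (Fin n → ℝ) → ℝ) : ℝ≥0∞ :=
  ∑' Q : S.cubes, (∏ j, avg (rinv j) (f j) Q.1) * volume Q.1

/-- The sparse operator `A_{r⃗,S}(f⃗) = ∑_{Q∈S} (∏_j ⟨f_j⟩_{r_j,Q}) χ_Q`. -/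
def sparseOp {n m : ℕ} (rinv : Fin m → ℝ) (S : SparseFamily n)
    (f : Fin m → (Fin n → ℝ) → ℝ) (x : Fin n → ℝ) : ℝ≥0∞ :=
  ∑' Q : S.cubes, (∏ j, avg (rinv j) (f j) Q.1) *
    (Q.1).indicator (fun _ => (1 : ℝ≥0∞)) x

end Paper
namespace Paper

/-- The centred maximal function with respect to `μ`, over closed balls of rational radius. -/
def centredMaximal {α : Type*} [PseudoMetricSpace α] [MeasurableSpace α] (μ : Measure α)
    (f : α → ℝ≥0∞) (x : α) : ℝ≥0∞ :=
  ⨆ r : {r : ℚ // 0 < r},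
    (∫⁻ y in Metric.closedBall x (r.1 : ℝ), f y ∂μ) / μ (Metric.closedBall x (r.1 : ℝ))

theorem mul_measure_le_of_forall_exists_closedBall {α : Type*} [MetricSpace α]
    [SecondCountableTopology α] [MeasurableSpace α] [OpensMeasurableSpace α] {N : ℕ} {τ : ℝ}
    (hτ : 1 < τ) (hN : IsEmpty (Besicovitch.SatelliteConfig α N τ)) (μ : Measure α)
    (f : α → ℝ≥0∞) (t : ℝ≥0∞) (R : ℝ) (E : Set α)
    (hE : ∀ x ∈ E, ∃ r : ℝ, 0 < r ∧ r ≤ R ∧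
      t * μ (Metric.closedBall x r) ≤ ∫⁻ y in Metric.closedBall x r, f y ∂μ) :
    t * μ E ≤ N * ∫⁻ y, f y ∂μ := by
  choose! r hr0 hrR hr using hE
  let q : Besicovitch.BallPackage E α :=
    { c := fun x => x
      r := fun x => r x
      rpos := fun x => hr0 x x.2
      r_bound := R
      r_le := fun x => hrR x x.2 }
  obtain ⟨s, hdisj, hcov⟩ := Besicovitch.exist_disjoint_covering_families hτ hN q
  have hcount : ∀ i, (s i).Countable := fun i =>
    (hdisj i).countable_of_nonempty_interior fun j _ =>
      ⟨(j : α), Metric.ball_subset_interior_closedBall (Metric.mem_ball_self (hr0 j j.2))⟩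
  have hEsub : E ⊆ ⋃ i : Fin N, ⋃ j ∈ s i, Metric.closedBall (j : α) (r j) := by
    intro x hx
    have h := hcov ⟨⟨x, hx⟩, rfl⟩
    simp only [Set.mem_iUnion] at h ⊢
    obtain ⟨i, j, hj, h⟩ := h
    exact ⟨i, j, hj, Metric.ball_subset_closedBall h⟩
  have hfam : ∀ i : Fin N,
      t * μ (⋃ j ∈ s i, Metric.closedBall (j : α) (r j)) ≤ ∫⁻ y, f y ∂μ := by
    intro i
    have := (hcount i).to_subtype
    calc t * μ (⋃ j ∈ s i, Metric.closedBall (j : α) (r j))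
        ≤ t * ∑' j : s i, μ (Metric.closedBall (j : α) (r j)) := by
          gcongr; exact measure_biUnion_le _ (hcount i) _
      _ = ∑' j : s i, t * μ (Metric.closedBall (j : α) (r j)) := ENNReal.tsum_mul_left.symm
      _ ≤ ∑' j : s i, ∫⁻ y in Metric.closedBall (j : α) (r j), f y ∂μ :=
          ENNReal.tsum_le_tsum fun j => hr _ j.1.2
      _ = ∫⁻ y in ⋃ j ∈ s i, Metric.closedBall (j : α) (r j), f y ∂μ :=
          (lintegral_biUnion (hcount i) (fun _ _ => Metric.isClosed_closedBall.measurableSet)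
            (hdisj i) f).symm
      _ ≤ ∫⁻ y, f y ∂μ := setLIntegral_le_lintegral _ _
  calc t * μ E ≤ t * ∑ i : Fin N, μ (⋃ j ∈ s i, Metric.closedBall (j : α) (r j)) := by
        gcongr
        refine (measure_mono hEsub).trans ?_
        exact (measure_iUnion_le _).trans_eq (tsum_fintype _)
    _ = ∑ i : Fin N, t * μ (⋃ j ∈ s i, Metric.closedBall (j : α) (r j)) := Finset.mul_sum _ _ _
    _ ≤ ∑ _i : Fin N, ∫⁻ y, f y ∂μ := Finset.sum_le_sum fun i _ => hfam i
    _ = N * ∫⁻ y, f y ∂μ := by simp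

theorem mul_measure_lt_centredMaximal_le {α : Type*} [MetricSpace α]
    [SecondCountableTopology α] [MeasurableSpace α] [OpensMeasurableSpace α] {N : ℕ} {τ : ℝ}
    (hτ : 1 < τ) (hN : IsEmpty (Besicovitch.SatelliteConfig α N τ)) (μ : Measure α)
    (f : α → ℝ≥0∞) (t : ℝ≥0∞) :
    t * μ {x | t < centredMaximal μ f x} ≤ N * ∫⁻ y, f y ∂μ := by
  let E : ℕ → Set α := fun R => {x | ∃ r : ℚ, 0 < r ∧ r ≤ R ∧
    t < (∫⁻ y in Metric.closedBall x (r : ℝ), f y ∂μ) / μ (Metric.closedBall x (r : ℝ))}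
  have hE : {x | t < centredMaximal μ f x} = ⋃ R, E R := by
    ext x
    simp only [centredMaximal, Set.mem_ofPred_eq, lt_iSup_iff, Set.mem_iUnion, E]
    constructor
    · rintro ⟨⟨r, hr⟩, h⟩
      obtain ⟨R, hR⟩ := exists_nat_ge r
      exact ⟨R, r, hr, hR, h⟩
    · rintro ⟨R, r, hr, -, h⟩
      exact ⟨⟨r, hr⟩, h⟩
  have hmono : Monotone E := by
    rintro R R' hRR x ⟨r, hr, hrR, h⟩
    exact ⟨r, hr, hrR.trans (by exact_mod_cast hRR), h⟩
  rw [hE, hmono.measure_iUnion, ENNReal.mul_iSup]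
  refine iSup_le fun R => mul_measure_le_of_forall_exists_closedBall hτ hN μ f t R _ ?_
  rintro x ⟨r, hr, hrR, h⟩
  exact ⟨r, by exact_mod_cast hr, by exact_mod_cast hrR, ENNReal.mul_le_of_le_div h.le⟩

theorem centredMaximal_le_add {α : Type*} [PseudoMetricSpace α] [MeasurableSpace α]
    [OpensMeasurableSpace α]
    (μ : Measure α) {f : α → ℝ≥0∞} (hf : Measurable f) (t : ℝ≥0∞) (x : α) :
    centredMaximal μ f x ≤ centredMaximal μ ({y | t < f y}.indicator f) x + t := by
  refine iSup_le fun r => ?_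
  have hS : MeasurableSet {y | t < f y} := measurableSet_lt measurable_const hf
  have h1 : ∫⁻ y in Metric.closedBall x (r.1 : ℝ), f y ∂μ ≤
      (∫⁻ y in Metric.closedBall x (r.1 : ℝ), {y | t < f y}.indicator f y ∂μ) +
        t * μ (Metric.closedBall x (r.1 : ℝ)) := by
    rw [← setLIntegral_const, ← lintegral_add_right _ measurable_const]
    refine lintegral_mono fun y => ?_
    by_cases hy : t < f y
    · simp [Set.indicator, hy]
    · simpa [Set.indicator, hy] using not_lt.1 hy
  calc _ ≤ _ := ENNReal.div_le_div_right h1 _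
    _ ≤ _ := by
      rw [ENNReal.add_div]
      gcongr
      · exact le_iSup (fun r : {r : ℚ // 0 < r} =>
          (∫⁻ y in Metric.closedBall x (r.1 : ℝ), {y | t < f y}.indicator f y ∂μ) /
            μ (Metric.closedBall x (r.1 : ℝ))) r
      · rw [mul_div_assoc]
        exact mul_le_of_le_one_right' ENNReal.div_self_le_one

theorem measurable_setLIntegral_closedBall {α : Type*} [PseudoMetricSpace α]
    [SecondCountableTopology α] [MeasurableSpace α] [OpensMeasurableSpace α]
    (μ : Measure α) [SFinite μ] {f : α → ℝ≥0∞} (hf : Measurable f) (r : ℝ) :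
    Measurable fun x => ∫⁻ y in Metric.closedBall x r, f y ∂μ := by
  have hS : MeasurableSet {p : α × α | dist p.2 p.1 ≤ r} :=
    measurableSet_le (measurable_snd.dist measurable_fst) measurable_const
  have h : (fun x => ∫⁻ y in Metric.closedBall x r, f y ∂μ) =
      fun x => ∫⁻ y, {p : α × α | dist p.2 p.1 ≤ r}.indicator (fun p => f p.2) (x, y) ∂μ := by
    ext x
    rw [← lintegral_indicator Metric.isClosed_closedBall.measurableSet]
    rfl
  rw [h]
  exact ((hf.comp measurable_snd).indicator hS).lintegral_prod_right'

theorem measurable_centredMaximal {α : Type*} [PseudoMetricSpace α]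
    [SecondCountableTopology α] [MeasurableSpace α] [OpensMeasurableSpace α]
    (μ : Measure α) [SFinite μ] {f : α → ℝ≥0∞} (hf : Measurable f) :
    Measurable (centredMaximal μ f) := by
  refine Measurable.iSup fun r => (measurable_setLIntegral_closedBall μ hf _).div ?_
  simpa using measurable_setLIntegral_closedBall μ (measurable_const (a := (1 : ℝ≥0∞))) (r.1 : ℝ)

theorem lintegral_Ioi_indicator_rpow {q : ℝ} (hq : 0 < q) (u : ℝ≥0∞) :
    ∫⁻ t in Set.Ioi (0 : ℝ), {t : ℝ | ENNReal.ofReal t < u}.indicator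
      (fun t => ENNReal.ofReal (t ^ (q - 1))) t = u ^ q / ENNReal.ofReal q := by
  have hm : MeasurableSet {t : ℝ | ENNReal.ofReal t < u} :=
    measurableSet_lt ENNReal.measurable_ofReal measurable_const
  have hfin : ∀ b : ℝ, 0 < b → ∫⁻ t in Set.Ioc (0 : ℝ) b, ENNReal.ofReal (t ^ (q - 1)) =
      ENNReal.ofReal (b ^ q / q) := by
    intro b hb
    rw [← ofReal_integral_eq_lintegral_ofReal]
    · rw [← intervalIntegral.integral_of_le hb.le, integral_rpow (Or.inl (by linarith))]
      simp [Real.zero_rpow hq.ne']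
    · exact (intervalIntegrable_iff_integrableOn_Ioc_of_le hb.le).1
        (intervalIntegral.intervalIntegrable_rpow' (by linarith))
    · filter_upwards [ae_restrict_mem measurableSet_Ioc] with t ht
      exact Real.rpow_nonneg ht.1.le _
  rw [lintegral_indicator hm, Measure.restrict_restrict hm]
  rcases eq_or_ne u ∞ with rfl | hu
  · have h1 : ({t : ℝ | ENNReal.ofReal t < ∞} ∩ Set.Ioi 0) = Set.Ioi 0 := by
      ext; simp
    rw [h1, ENNReal.top_rpow_of_pos hq, ENNReal.top_div_of_ne_top ENNReal.ofReal_ne_top]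
    refine ENNReal.eq_top_of_forall_nnreal_le fun y => ?_
    have h2 := hfin ((y * q + 1) ^ (1 / q)) (by positivity)
    rw [← Real.rpow_mul (by positivity), one_div_mul_cancel hq.ne', Real.rpow_one] at h2
    calc (y : ℝ≥0∞) = ENNReal.ofReal y := by simp
      _ ≤ ENNReal.ofReal ((y * q + 1) / q) := by
        gcongr
        rw [le_div_iff₀ hq]; linarith
      _ ≤ _ := by
        rw [← h2]
        exact lintegral_mono_set Set.Ioc_subset_Ioi_self
  · lift u to NNReal using hu
    rcases eq_or_ne u 0 with rfl | hu0
    · simp [hq]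
    have hu0' : 0 < (u : ℝ) := by positivity
    have h1 : ({t : ℝ | ENNReal.ofReal t < u} ∩ Set.Ioi 0) = Set.Ioo 0 (u : ℝ) := by
      ext t
      simp only [Set.mem_inter_iff, Set.mem_ofPred_eq, Set.mem_Ioi, Set.mem_Ioo]
      rw [and_comm]
      refine and_congr_right fun ht => ?_
      rw [← ENNReal.ofReal_coe_nnreal, ENNReal.ofReal_lt_ofReal_iff hu0']
    rw [h1, restrict_Ioo_eq_restrict_Ioc, hfin _ hu0', ENNReal.ofReal_div_of_pos hq,
      ← ENNReal.ofReal_rpow_of_pos hu0', ENNReal.ofReal_coe_nnreal]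

theorem lintegral_centredMaximal_rpow_le {α : Type*} [MetricSpace α]
    [SecondCountableTopology α] [MeasurableSpace α] [OpensMeasurableSpace α] {N : ℕ} {τ : ℝ}
    (hτ : 1 < τ) (hN : IsEmpty (Besicovitch.SatelliteConfig α N τ)) (μ : Measure α) [SFinite μ]
    {f : α → ℝ≥0∞} (hf : Measurable f) {p : ℝ} (hp : 1 < p) :
    ∫⁻ x, centredMaximal μ f x ^ p ∂μ ≤
      ENNReal.ofReal p * (2 * N * (2 ^ (p - 1) / ENNReal.ofReal (p - 1))) *
        ∫⁻ x, f x ^ p ∂μ := by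
  have hp0 : 0 < p := by linarith
  have hM := measurable_centredMaximal μ hf
  have hlayer : ∀ u : ℝ≥0∞, u ^ p = ENNReal.ofReal p * ∫⁻ t in Set.Ioi (0 : ℝ),
      {t : ℝ | ENNReal.ofReal t < u}.indicator (fun t => ENNReal.ofReal (t ^ (p - 1))) t := by
    intro u
    rw [lintegral_Ioi_indicator_rpow hp0, ENNReal.mul_div_cancel (by simpa) ofReal_ne_top]
  have hweak : ∀ t : ℝ, 0 < t → ENNReal.ofReal t * μ {x | ENNReal.ofReal t < centredMaximal μ f x} ≤
      2 * N * ∫⁻ y, {y | ENNReal.ofReal t < 2 * f y}.indicator f y ∂μ := by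
    intro t ht
    set s : ℝ≥0∞ := ENNReal.ofReal (t / 2) with hs
    have hts : ENNReal.ofReal t = 2 * s := by
      rw [hs, ← ENNReal.ofReal_ofNat 2, ← ENNReal.ofReal_mul (by norm_num)]; congr 1; ring
    have hset : {y | ENNReal.ofReal t < 2 * f y} = {y | s < f y} := by
      ext y
      simp only [Set.mem_ofPred_eq, hts]
      exact ENNReal.mul_lt_mul_iff_right (by norm_num) (by norm_num)
    rw [hset, hts, mul_assoc, mul_assoc]
    refine mul_le_mul_right (le_trans ?_
      (mul_measure_lt_centredMaximal_le hτ hN μ ({y | s < f y}.indicator f) s)) 2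
    refine mul_le_mul_right (measure_mono fun x hx => ?_) s
    replace hx : 2 * s < centredMaximal μ f x := hx
    have h := hx.trans_le (centredMaximal_le_add μ hf s x)
    rw [two_mul] at h
    exact lt_of_add_lt_add_right h
  have hmeasM : Measurable (Function.uncurry fun (x : α) (t : ℝ) =>
      {t : ℝ | ENNReal.ofReal t < centredMaximal μ f x}.indicator
        (fun t => ENNReal.ofReal (t ^ (p - 1))) t) := by
    have : (Function.uncurry fun (x : α) (t : ℝ) =>
      {t : ℝ | ENNReal.ofReal t < centredMaximal μ f x}.indicator
        (fun t => ENNReal.ofReal (t ^ (p - 1))) t) =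
        {z : α × ℝ | ENNReal.ofReal z.2 < centredMaximal μ f z.1}.indicator
          (fun z => ENNReal.ofReal (z.2 ^ (p - 1))) := rfl
    rw [this]
    exact (by fun_prop : Measurable fun z : α × ℝ => ENNReal.ofReal (z.2 ^ (p - 1))).indicator
      (measurableSet_lt (by fun_prop) (hM.comp measurable_fst))
  have hmeasf : Measurable (Function.uncurry fun (t : ℝ) (x : α) =>
      ENNReal.ofReal (t ^ (p - 1 - 1)) *
        {y | ENNReal.ofReal t < 2 * f y}.indicator f x) := by
    have : (Function.uncurry fun (t : ℝ) (x : α) =>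
      ENNReal.ofReal (t ^ (p - 1 - 1)) * {y | ENNReal.ofReal t < 2 * f y}.indicator f x) =
        fun z => ENNReal.ofReal (z.1 ^ (p - 1 - 1)) *
          {z : ℝ × α | ENNReal.ofReal z.1 < 2 * f z.2}.indicator (fun z => f z.2) z := rfl
    rw [this]
    exact (by fun_prop : Measurable fun z : ℝ × α => ENNReal.ofReal (z.1 ^ (p - 1 - 1))).mul
      ((hf.comp measurable_snd).indicator
        (measurableSet_lt (by fun_prop) ((hf.comp measurable_snd).const_mul 2)))
  calc ∫⁻ x, centredMaximal μ f x ^ p ∂μ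
      = ENNReal.ofReal p * ∫⁻ x, (∫⁻ t in Set.Ioi (0 : ℝ),
          {t : ℝ | ENNReal.ofReal t < centredMaximal μ f x}.indicator
            (fun t => ENNReal.ofReal (t ^ (p - 1))) t) ∂μ := by
        rw [← lintegral_const_mul' _ _ ofReal_ne_top]
        exact lintegral_congr fun x => hlayer _
    _ = ENNReal.ofReal p * ∫⁻ t in Set.Ioi (0 : ℝ), ∫⁻ x,
          {t : ℝ | ENNReal.ofReal t < centredMaximal μ f x}.indicator
            (fun t => ENNReal.ofReal (t ^ (p - 1))) t ∂μ := by
        rw [lintegral_lintegral_swap hmeasM.aemeasurable]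
    _ ≤ ENNReal.ofReal p * ∫⁻ t in Set.Ioi (0 : ℝ), 2 * N * ∫⁻ x,
          ENNReal.ofReal (t ^ (p - 1 - 1)) *
            {y | ENNReal.ofReal t < 2 * f y}.indicator f x ∂μ := by
        gcongr ENNReal.ofReal p * ?_
        refine setLIntegral_mono' measurableSet_Ioi fun t (ht : 0 < t) => ?_
        have h1 : ∀ x, {t : ℝ | ENNReal.ofReal t < centredMaximal μ f x}.indicator
            (fun t => ENNReal.ofReal (t ^ (p - 1))) t =
            {x | ENNReal.ofReal t < centredMaximal μ f x}.indicator
              (fun _ => ENNReal.ofReal (t ^ (p - 1))) x := fun x => rfl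
        simp_rw [h1]
        rw [lintegral_indicator_const (measurableSet_lt measurable_const hM),
          lintegral_const_mul' _ _ ofReal_ne_top, mul_left_comm]
        have h2 : t ^ (p - 1) = t ^ (p - 1 - 1) * t := by
          rw [← Real.rpow_add_one ht.ne']; ring_nf
        rw [h2, ENNReal.ofReal_mul (by positivity), mul_assoc]
        exact mul_le_mul_right (hweak t ht) _
    _ = ENNReal.ofReal p * (2 * N * ∫⁻ x, (∫⁻ t in Set.Ioi (0 : ℝ),
          ENNReal.ofReal (t ^ (p - 1 - 1)) *
            {y | ENNReal.ofReal t < 2 * f y}.indicator f x) ∂μ) := by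
        rw [lintegral_const_mul' _ _ (by finiteness),
          lintegral_lintegral_swap hmeasf.aemeasurable]
    _ = ENNReal.ofReal p * (2 * N * ∫⁻ x, (2 ^ (p - 1) / ENNReal.ofReal (p - 1)) * f x ^ p ∂μ) := by
        congr 2
        refine lintegral_congr fun x => ?_
        have h1 : ∀ t : ℝ, ENNReal.ofReal (t ^ (p - 1 - 1)) *
            {y | ENNReal.ofReal t < 2 * f y}.indicator f x =
            {t : ℝ | ENNReal.ofReal t < 2 * f x}.indicator
              (fun t => ENNReal.ofReal (t ^ (p - 1 - 1))) t * f x := by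
          intro t
          by_cases h : ENNReal.ofReal t < 2 * f x <;> simp [Set.indicator, h]
        simp_rw [h1]
        rw [lintegral_mul_const _ (Measurable.indicator (by fun_prop)
          (measurableSet_lt (by fun_prop) measurable_const)),
          lintegral_Ioi_indicator_rpow (by linarith), ENNReal.mul_rpow_of_nonneg _ _ (by linarith),
          ENNReal.mul_div_right_comm, mul_assoc]
        congr 1
        conv_lhs => rw [← ENNReal.rpow_one (f x), ← ENNReal.rpow_mul, one_mul]
        rw [← ENNReal.rpow_add_of_nonneg _ _ (by linarith) (by norm_num)]
        simp
    _ = _ := by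
        rw [lintegral_const_mul _ (hf.pow_const p)]
        ring

theorem exists_monotone_seq_of_lintegral_le {α : Type*} [MeasurableSpace α] {μ : Measure α}
    (T : (α → ℝ≥0∞) → α → ℝ≥0∞) (hTmono : Monotone T)
    (hTmeas : ∀ G, Measurable G → Measurable (T G))
    (hT : ∀ G, Measurable G → ∫⁻ x, T G x ∂μ ≤ 3⁻¹ * ∫⁻ x, G x ∂μ)
    {G₀ : α → ℝ≥0∞} (hG₀ : Measurable G₀) :
    ∃ s : ℕ → α → ℝ≥0∞, Monotone s ∧ (∀ l, Measurable (s l)) ∧ G₀ ≤ s 0 ∧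
      (∀ l, T (s l) ≤ s (l + 1)) ∧ ∫⁻ x, (⨆ l, s l x) ∂μ ≤ 3 / 2 * ∫⁻ x, G₀ x ∂μ := by
  let s : ℕ → α → ℝ≥0∞ := fun l => Nat.rec G₀ (fun _ g => G₀ + T g) l
  have hs : ∀ l, s (l + 1) = G₀ + T (s l) := fun l => rfl
  have hmono : Monotone s := by
    refine monotone_nat_of_le_succ fun l => ?_
    induction l with
    | zero => exact le_self_add
    | succ l ih => rw [hs, hs (l + 1)]; exact add_le_add le_rfl (hTmono ih)
  have hmeas : ∀ l, Measurable (s l) := by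
    intro l
    induction l with
    | zero => exact hG₀
    | succ l ih => rw [hs]; exact hG₀.add (hTmeas _ ih)
  have hbd : ∀ l, ∫⁻ x, s l x ∂μ ≤ 3 / 2 * ∫⁻ x, G₀ x ∂μ := by
    have hc : (1 : ℝ≥0∞) + 3⁻¹ * (3 / 2) = 3 / 2 := by
      rw [div_eq_mul_inv, ← mul_assoc, ENNReal.inv_mul_cancel (by norm_num) (by norm_num), one_mul]
      rw [← ENNReal.toReal_eq_toReal_iff' (by finiteness) (by finiteness),
        ENNReal.toReal_add (by finiteness) (by finiteness)]
      simp; norm_num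
    intro l
    induction l with
    | zero =>
      refine le_mul_of_one_le_left' ?_
      rw [← hc]; exact le_self_add
    | succ l ih =>
      rw [hs]
      calc ∫⁻ x, (G₀ + T (s l)) x ∂μ = ∫⁻ x, G₀ x ∂μ + ∫⁻ x, T (s l) x ∂μ :=
            lintegral_add_left hG₀ _
        _ ≤ ∫⁻ x, G₀ x ∂μ + 3⁻¹ * (3 / 2 * ∫⁻ x, G₀ x ∂μ) := by
            gcongr
            exact (hT _ (hmeas l)).trans (mul_le_mul_right ih _)
        _ = (1 + 3⁻¹ * (3 / 2)) * ∫⁻ x, G₀ x ∂μ := by ring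
        _ = _ := by rw [hc]
  refine ⟨s, hmono, hmeas, le_rfl, fun l => ?_, ?_⟩
  · rw [hs]; exact le_add_self
  · rw [lintegral_iSup hmeas hmono]
    exact iSup_le hbd

theorem centredMaximal_mono {α : Type*} [PseudoMetricSpace α] [MeasurableSpace α] (μ : Measure α)
    {f g : α → ℝ≥0∞} (h : f ≤ g) (x : α) : centredMaximal μ f x ≤ centredMaximal μ g x :=
  iSup_mono fun _ => ENNReal.div_le_div_right (lintegral_mono h) _

/-- The operator `G ↦ v · (M^v ((G/v)^a))^{1/a}`, which acts on densities. -/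
def densityMaximal {α : Type*} [PseudoMetricSpace α] [MeasurableSpace α] (μ : Measure α)
    (v : α → ℝ≥0∞) (a : ℝ) (G : α → ℝ≥0∞) (x : α) : ℝ≥0∞ :=
  v x * centredMaximal (μ.withDensity v) (fun y => (G y / v y) ^ a) x ^ (1 / a)

theorem lintegral_densityMaximal_le {α : Type*} [MetricSpace α]
    [SecondCountableTopology α] [MeasurableSpace α] [OpensMeasurableSpace α] {N : ℕ} {τ : ℝ}
    (hτ : 1 < τ) (hN : IsEmpty (Besicovitch.SatelliteConfig α N τ)) (μ : Measure α) [SFinite μ]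
    {v : α → ℝ≥0∞} (hv : Measurable v) (hv0 : ∀ x, v x ≠ 0) (hvt : ∀ x, v x ≠ ∞)
    {a : ℝ} (ha0 : 0 < a) (ha1 : a < 1) {G : α → ℝ≥0∞} (hG : Measurable G) :
    ∫⁻ x, densityMaximal μ v a G x ∂μ ≤
      ENNReal.ofReal (1 / a) * (2 * N * (2 ^ (1 / a - 1) / ENNReal.ofReal (1 / a - 1))) *
        ∫⁻ x, G x ∂μ := by
  have hf : Measurable fun y => (G y / v y) ^ a := (hG.div hv).pow_const a
  have hM := measurable_centredMaximal (μ.withDensity v) hf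
  have h := lintegral_centredMaximal_rpow_le hτ hN (μ.withDensity v) hf
    (p := 1 / a) ((one_lt_div ha0).2 ha1)
  rw [lintegral_withDensity_eq_lintegral_mul _ hv (hM.pow_const _),
    lintegral_withDensity_eq_lintegral_mul _ hv (hf.pow_const _)] at h
  refine h.trans_eq ?_
  congr 1
  refine lintegral_congr fun x => ?_
  rw [Pi.mul_apply, ← ENNReal.rpow_mul, mul_one_div_cancel ha0.ne', ENNReal.rpow_one,
    ENNReal.mul_div_cancel (hv0 x) (hvt x)]

theorem measurable_densityMaximal {α : Type*} [PseudoMetricSpace α]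
    [SecondCountableTopology α] [MeasurableSpace α] [OpensMeasurableSpace α]
    (μ : Measure α) [SFinite μ] {v : α → ℝ≥0∞} (hv : Measurable v) (a : ℝ) {G : α → ℝ≥0∞}
    (hG : Measurable G) : Measurable (densityMaximal μ v a G) :=
  hv.mul ((measurable_centredMaximal _ ((hG.div hv).pow_const a)).pow_const _)

theorem densityMaximal_mono {α : Type*} [PseudoMetricSpace α] [MeasurableSpace α] (μ : Measure α)
    (v : α → ℝ≥0∞) {a : ℝ} (ha : 0 < a) : Monotone (densityMaximal μ v a) := by
  intro G H h x
  refine mul_le_mul_right (ENNReal.rpow_le_rpow (centredMaximal_mono _ (fun y => ?_) x)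
    (by positivity)) _
  exact ENNReal.rpow_le_rpow (ENNReal.div_le_div_right (h y) _) ha.le

theorem setLIntegral_div_rpow_le_of_densityMaximal_le {α : Type*} [PseudoMetricSpace α]
    [MeasurableSpace α] (μ : Measure α) {v : α → ℝ≥0∞} {x : α} (hv0 : v x ≠ 0) (hvt : v x ≠ ∞)
    {a : ℝ} (ha : 0 < a) {G : α → ℝ≥0∞} {A : ℝ≥0∞} (h : densityMaximal μ v a G x ≤ A)
    {r : ℚ} (hr : 0 < r)
    (hfin : (μ.withDensity v) (Metric.closedBall x (r : ℝ)) ≠ ∞) :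
    ∫⁻ y in Metric.closedBall x (r : ℝ), (G y / v y) ^ a ∂(μ.withDensity v) ≤
      (A / v x) ^ a * (μ.withDensity v) (Metric.closedBall x (r : ℝ)) := by
  set ν := μ.withDensity v
  rcases eq_or_ne (ν (Metric.closedBall x (r : ℝ))) 0 with h0 | h0
  · rw [setLIntegral_measure_zero _ _ h0]; exact zero_le
  have h1 : (∫⁻ y in Metric.closedBall x (r : ℝ), (G y / v y) ^ a ∂ν) /
      ν (Metric.closedBall x (r : ℝ)) ≤ centredMaximal ν (fun y => (G y / v y) ^ a) x :=
    le_iSup (fun r : {r : ℚ // 0 < r} => (∫⁻ y in Metric.closedBall x (r.1 : ℝ),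
      (G y / v y) ^ a ∂ν) / ν (Metric.closedBall x (r.1 : ℝ))) ⟨r, hr⟩
  have h2 : centredMaximal ν (fun y => (G y / v y) ^ a) x ≤ (A / v x) ^ a := by
    have h3 : centredMaximal ν (fun y => (G y / v y) ^ a) x ^ (1 / a) ≤ A / v x := by
      rw [ENNReal.le_div_iff_mul_le (Or.inl hv0) (Or.inl hvt), mul_comm]
      exact h
    have h4 := ENNReal.rpow_le_rpow h3 ha.le
    rwa [← ENNReal.rpow_mul, one_div_mul_cancel ha.ne', ENNReal.rpow_one] at h4
  exact (ENNReal.div_le_iff_le_mul (Or.inl h0) (Or.inl hfin)).1 (h1.trans h2)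

theorem exists_majorant_closedBall {α ι : Type*} [Fintype ι] [MetricSpace α]
    [SecondCountableTopology α] [MeasurableSpace α] [OpensMeasurableSpace α]
    [HasBesicovitchCovering α] (a : ι → ℝ) (ha0 : ∀ k, 0 < a k) (ha1 : ∀ k, a k < 1) :
    ∃ D : ℝ≥0∞, 1 ≤ D ∧ D ≠ ∞ ∧ ∀ (μ : Measure α) [SFinite μ] (v : ι → α → ℝ≥0∞),
      (∀ k, Measurable (v k)) → (∀ k x, v k x ≠ 0) → (∀ k x, v k x ≠ ∞) →
      ∀ G₀ : α → ℝ≥0∞, Measurable G₀ → ∃ G : α → ℝ≥0∞, Measurable G ∧ G₀ ≤ G ∧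
        ∫⁻ x, G x ∂μ ≤ 3 / 2 * ∫⁻ x, G₀ x ∂μ ∧
        ∀ k x (r : ℚ), 0 < r → μ.withDensity (v k) (Metric.closedBall x (r : ℝ)) ≠ ∞ →
          ∫⁻ y in Metric.closedBall x (r : ℝ), (G y / v k y) ^ a k ∂(μ.withDensity (v k)) ≤
            D * (G x / v k x) ^ a k * μ.withDensity (v k) (Metric.closedBall x (r : ℝ)) := by
  obtain ⟨N, τ, hτ, hN⟩ := HasBesicovitchCovering.no_satelliteConfig (α := α)
  set c : ι → ℝ≥0∞ := fun k =>
    ENNReal.ofReal (1 / a k) * (2 * N * (2 ^ (1 / a k - 1) / ENNReal.ofReal (1 / a k - 1))) with hc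
  have hct : ∀ k, c k ≠ ∞ := by
    intro k
    have h1 : 0 < 1 / a k - 1 := by
      have := (one_lt_div (ha0 k)).2 (ha1 k); linarith
    have h2 : ENNReal.ofReal (1 / a k - 1) ≠ 0 := by simpa using h1
    simp only [hc]
    refine ENNReal.mul_ne_top ofReal_ne_top (ENNReal.mul_ne_top (by finiteness)
      (ENNReal.div_ne_top (ENNReal.rpow_ne_top_of_nonneg h1.le (by norm_num)) h2))
  set S : ℝ≥0∞ := ∑ k, c k with hS
  have hSt : S ≠ ∞ := ENNReal.sum_ne_top.2 fun k _ => hct k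
  set D : ℝ≥0∞ := 3 * (S + 1) with hD
  have hD1 : 1 ≤ D := by
    rw [hD, mul_add, mul_one]
    exact le_add_left (by norm_num)
  have hDt : D ≠ ∞ := by finiteness
  have hD0 : D ≠ 0 := (zero_lt_one.trans_le hD1).ne'
  refine ⟨D, hD1, hDt, fun μ _ v hv hv0 hvt G₀ hG₀ => ?_⟩
  let T : (α → ℝ≥0∞) → α → ℝ≥0∞ := fun G x => D⁻¹ * ∑ k, densityMaximal μ (v k) (a k) G x
  have hTmono : Monotone T := fun G H h x =>
    mul_le_mul_right (Finset.sum_le_sum fun k _ => densityMaximal_mono μ (v k) (ha0 k) h x) _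
  have hTmeas : ∀ G, Measurable G → Measurable (T G) := fun G hG =>
    (Finset.measurable_fun_sum _ fun k _ =>
      measurable_densityMaximal μ (hv k) (a k) hG).const_mul _
  have hT : ∀ G, Measurable G → ∫⁻ x, T G x ∂μ ≤ 3⁻¹ * ∫⁻ x, G x ∂μ := by
    intro G hG
    simp only [T]
    rw [lintegral_const_mul' _ _ (ENNReal.inv_ne_top.2 hD0),
      lintegral_finsetSum _ fun k _ => measurable_densityMaximal μ (hv k) (a k) hG]
    calc D⁻¹ * ∑ k, ∫⁻ x, densityMaximal μ (v k) (a k) G x ∂μ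
        ≤ D⁻¹ * ∑ k, c k * ∫⁻ x, G x ∂μ := by
          refine mul_le_mul_right (Finset.sum_le_sum fun k _ => ?_) _
          exact lintegral_densityMaximal_le hτ hN μ (hv k) (hv0 k) (hvt k) (ha0 k) (ha1 k) hG
      _ = (D⁻¹ * S) * ∫⁻ x, G x ∂μ := by rw [← Finset.sum_mul, mul_assoc]
      _ ≤ 3⁻¹ * ∫⁻ x, G x ∂μ := by
          gcongr
          rw [mul_comm, ← div_eq_mul_inv]
          refine ENNReal.div_le_of_le_mul ?_
          rw [hD, ← mul_assoc, ENNReal.inv_mul_cancel (by norm_num) (by norm_num), one_mul]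
          exact le_self_add
  obtain ⟨s, hmono, hmeas, hs0, hsT, hint⟩ :=
    exists_monotone_seq_of_lintegral_le T hTmono hTmeas hT hG₀
  refine ⟨fun x => ⨆ l, s l x, Measurable.iSup hmeas,
    fun x => (hs0 x).trans (le_iSup (fun l => s l x) 0), hint, fun k x r hr hfin => ?_⟩
  have hsup : ∀ y, ((⨆ l, s l y) / v k y) ^ a k = ⨆ l, (s l y / v k y) ^ a k := by
    intro y
    rw [ENNReal.iSup_div]
    exact (ENNReal.orderIsoRpow (a k) (ha0 k)).map_iSup _
  simp_rw [hsup]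
  rw [lintegral_iSup (f := fun l y => (s l y / v k y) ^ a k)
    (fun l => ((hmeas l).div (hv k)).pow_const _)
    (fun l l' h y => ENNReal.rpow_le_rpow (ENNReal.div_le_div_right (hmono h y) _) (ha0 k).le)]
  refine iSup_le fun l => ?_
  have hle : densityMaximal μ (v k) (a k) (s l) x ≤ D * ⨆ l, s l x := by
    have h1 : D⁻¹ * densityMaximal μ (v k) (a k) (s l) x ≤ ⨆ l, s l x := by
      refine le_trans ?_ (le_iSup (fun l => s l x) (l + 1))
      refine le_trans ?_ (hsT l x)
      exact mul_le_mul_right (Finset.single_le_sum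
        (f := fun k => densityMaximal μ (v k) (a k) (s l) x) (fun _ _ => zero_le)
        (Finset.mem_univ k)) _
    calc _ = D * (D⁻¹ * densityMaximal μ (v k) (a k) (s l) x) := by
          rw [← mul_assoc, ENNReal.mul_inv_cancel hD0 hDt, one_mul]
      _ ≤ _ := mul_le_mul_right h1 _
  refine (setLIntegral_div_rpow_le_of_densityMaximal_le μ (hv0 k x) (hvt k x) (ha0 k) hle hr
    hfin).trans ?_
  rw [mul_div_assoc, ENNReal.mul_rpow_of_nonneg _ _ (ha0 k).le, ← hsup]
  gcongr
  exact (ENNReal.rpow_le_rpow_of_exponent_le hD1 (ha1 k).le).trans_eq (ENNReal.rpow_one D)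

theorem volume_pi_Ico_add {n : ℕ} (c : Fin n → ℝ) (h : ℝ) :
    volume (Set.univ.pi fun i => Set.Ico (c i) (c i + h)) = ENNReal.ofReal h ^ n := by
  rw [volume_pi, Measure.pi_pi]
  simp

/-- A common majorant of `G₀` which is, for every `k`, almost a power of an `A₁` weight relative
to `v k`, with respect to cubes. -/
theorem exists_majorant_cube {n : ℕ} {ι : Type*} [Fintype ι] (a : ι → ℝ) (ha0 : ∀ k, 0 < a k)
    (ha1 : ∀ k, a k < 1) :
    ∃ D : ℝ≥0∞, 1 ≤ D ∧ D ≠ ∞ ∧ ∀ v : ι → (Fin n → ℝ) → ℝ≥0∞,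
      (∀ k, Measurable (v k)) → (∀ k x, v k x ≠ 0) → (∀ k x, v k x ≠ ∞) →
      (∀ k Q, IsCube Q → ∫⁻ x in Q, v k x ≠ ∞) →
      ∀ G₀ : (Fin n → ℝ) → ℝ≥0∞, Measurable G₀ → (∀ x, G₀ x ≠ 0) → ∫⁻ x, G₀ x ≠ ∞ →
      ∃ G : (Fin n → ℝ) → ℝ, Measurable G ∧ (∀ x, 0 < G x) ∧
        (∀ᵐ x, G₀ x ≤ ENNReal.ofReal (G x)) ∧
        ∫⁻ x, ENNReal.ofReal (G x) ≤ 3 / 2 * ∫⁻ x, G₀ x ∧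
        ∀ Q, IsCube Q → ∃ Q', IsCube Q' ∧
          ∀ k, (volume Q)⁻¹ * ∫⁻ y in Q, v k y ≤ D * ((volume Q')⁻¹ * ∫⁻ y in Q', v k y) ∧
          ∀ᵐ x ∂(volume.restrict Q),
            (volume Q)⁻¹ * ∫⁻ y in Q, ENNReal.ofReal (G y) ^ a k * v k y ^ (1 - a k) ≤
              (ENNReal.ofReal (G x) / v k x) ^ a k *
                (D * ((volume Q')⁻¹ * ∫⁻ y in Q', v k y)) := by
  obtain ⟨D, hD1, hDt, hD⟩ := exists_majorant_closedBall (α := Fin n → ℝ) a ha0 ha1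
  refine ⟨D * 5 ^ n, one_le_mul hD1 (one_le_pow_of_one_le' (by norm_num) n), by finiteness,
    fun v hv hv0 hvt hvQ G₀ hG₀ hG₀0 hG₀t => ?_⟩
  obtain ⟨H, hHm, hGH, hHint, hH⟩ := hD volume v hv hv0 hvt G₀ hG₀
  have hHfin : ∀ᵐ x, H x < ∞ :=
    ae_lt_top hHm (hHint.trans_lt (ENNReal.mul_lt_top (by finiteness) hG₀t.lt_top)).ne
  set G : (Fin n → ℝ) → ℝ := fun x => if H x = ∞ then 1 else (H x).toReal with hG
  have hGae : ∀ᵐ x, ENNReal.ofReal (G x) = H x := by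
    filter_upwards [hHfin] with x hx
    simp [hG, hx.ne]
  refine ⟨G, ?_, ?_, ?_, ?_, ?_⟩
  · exact Measurable.ite (hHm (measurableSet_singleton ∞)) measurable_const hHm.ennreal_toReal
  · intro x
    by_cases hx : H x = ∞
    · simp [hG, hx]
    · simp only [hG, hx, if_false]
      exact ENNReal.toReal_pos (fun h0 => hG₀0 x (le_antisymm ((hGH x).trans h0.le) zero_le)) hx
  · filter_upwards [hGae] with x hx
    rw [hx]; exact hGH x
  · rw [lintegral_congr_ae hGae]; exact hHint
  · rintro Q ⟨c, h, hh, rfl⟩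
    set Q : Set (Fin n → ℝ) := Set.univ.pi fun i => Set.Ico (c i) (c i + h) with hQ
    set Q' : Set (Fin n → ℝ) :=
      Set.univ.pi fun i => Set.Ico (c i - 2 * h) (c i - 2 * h + 5 * h) with hQ'
    have hQ'c : IsCube Q' := ⟨fun i => c i - 2 * h, 5 * h, by positivity, rfl⟩
    have hvol : volume Q = ENNReal.ofReal h ^ n := volume_pi_Ico_add c h
    have hvol' : volume Q' = 5 ^ n * volume Q := by
      rw [hvol, hQ', volume_pi_Ico_add (fun i => c i - 2 * h), ENNReal.ofReal_mul (by norm_num),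
        mul_pow]
      norm_num
    have hinv : (volume Q)⁻¹ = 5 ^ n * (volume Q')⁻¹ := by
      rw [hvol', ENNReal.mul_inv (by left; positivity) (by left; finiteness), ← mul_assoc,
        ENNReal.mul_inv_cancel (by positivity) (by finiteness), one_mul]
    have hsub : Q ⊆ Q' := Set.pi_mono fun i _ => Set.Ico_subset_Ico (by linarith) (by linarith)
    have hQm : MeasurableSet Q := MeasurableSet.univ_pi fun i => measurableSet_Ico
    refine ⟨Q', hQ'c, fun k => ⟨?_, ?_⟩⟩
    · rw [hinv]
      calc 5 ^ n * (volume Q')⁻¹ * ∫⁻ y in Q, v k y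
          ≤ 5 ^ n * (volume Q')⁻¹ * ∫⁻ y in Q', v k y := by gcongr
        _ = 1 * 5 ^ n * ((volume Q')⁻¹ * ∫⁻ y in Q', v k y) := by ring
        _ ≤ _ := by gcongr
    · filter_upwards [ae_restrict_mem hQm, ae_restrict_of_ae hGae] with x hx hGx
      obtain ⟨r, hr1, hr2⟩ := exists_rat_btwn (show h < 2 * h by linarith)
      have hr0 : 0 < r := by exact_mod_cast hh.trans hr1
      have hQx : ∀ i, c i ≤ x i ∧ x i < c i + h := fun i => by
        simpa using hx i (Set.mem_univ i)
      have hQb : Q ⊆ Metric.closedBall x (r : ℝ) := by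
        intro y hy
        rw [Metric.mem_closedBall, dist_pi_le_iff (by positivity)]
        intro i
        have h1 : c i ≤ y i ∧ y i < c i + h := by simpa using hy i (Set.mem_univ i)
        have h2 := hQx i
        rw [Real.dist_eq, abs_le]
        constructor <;> linarith
      have hbQ : Metric.closedBall x (r : ℝ) ⊆ Q' := by
        intro y hy i _
        rw [Metric.mem_closedBall, dist_pi_le_iff (by positivity)] at hy
        have h1 := hy i
        have h2 := hQx i
        rw [Real.dist_eq, abs_le] at h1
        constructor <;> linarith
      have hbm : MeasurableSet (Metric.closedBall x (r : ℝ)) := measurableSet_closedBall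
      have hwd : volume.withDensity (v k) (Metric.closedBall x (r : ℝ)) ≤ ∫⁻ y in Q', v k y := by
        rw [withDensity_apply _ hbm]
        exact lintegral_mono_set hbQ
      have hmain := hH k x r hr0 (ne_top_of_le_ne_top (hvQ k Q' hQ'c) hwd)
      have hle : ∫⁻ y in Q, ENNReal.ofReal (G y) ^ a k * v k y ^ (1 - a k) ≤
          D * (H x / v k x) ^ a k * ∫⁻ y in Q', v k y := by
        calc ∫⁻ y in Q, ENNReal.ofReal (G y) ^ a k * v k y ^ (1 - a k)
            = ∫⁻ y in Q, (v k * fun y => (H y / v k y) ^ a k) y := by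
              refine lintegral_congr_ae ?_
              filter_upwards [ae_restrict_of_ae hGae] with y hy
              rw [hy, Pi.mul_apply, ENNReal.div_rpow_of_nonneg _ _ (ha0 k).le,
                ENNReal.rpow_sub _ _ (hv0 k y) (hvt k y), ENNReal.rpow_one]
              simp only [div_eq_mul_inv]
              ring
          _ ≤ ∫⁻ y in Metric.closedBall x (r : ℝ), (v k * fun y => (H y / v k y) ^ a k) y :=
              lintegral_mono_set hQb
          _ = ∫⁻ y in Metric.closedBall x (r : ℝ), (H y / v k y) ^ a k
                ∂(volume.withDensity (v k)) := by
              have hf : Measurable fun y => (H y / v k y) ^ a k := (hHm.div (hv k)).pow_const _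
              exact (setLIntegral_withDensity_eq_setLIntegral_mul _ (hv k) hf hbm).symm
          _ ≤ _ := hmain
          _ ≤ _ := by gcongr
      rw [hGx]
      calc _ ≤ (volume Q)⁻¹ * (D * (H x / v k x) ^ a k * ∫⁻ y in Q', v k y) := by gcongr
        _ = _ := by rw [hinv]; ring

/-- The `L^{1/ρ}(μ)` quasinorm of an `ℝ≥0∞`-valued function; `ρ = 0` encodes the essential
supremum. -/
def powNorm {α : Type*} [MeasurableSpace α] (ρ : ℝ) (F : α → ℝ≥0∞) (μ : Measure α) : ℝ≥0∞ :=
  if ρ = 0 then essSup F μ else (∫⁻ x, F x ^ (1 / ρ) ∂μ) ^ ρ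

theorem powNorm_mono_ae {α : Type*} [MeasurableSpace α] {μ : Measure α} {ρ : ℝ} (hρ : 0 ≤ ρ)
    {F H : α → ℝ≥0∞} (h : ∀ᵐ x ∂μ, F x ≤ H x) : powNorm ρ F μ ≤ powNorm ρ H μ := by
  unfold powNorm
  split_ifs with h0
  · exact essSup_mono_ae h
  · refine ENNReal.rpow_le_rpow (lintegral_mono_ae ?_) hρ
    filter_upwards [h] with x hx
    exact ENNReal.rpow_le_rpow hx (by positivity)

theorem powNorm_const_mul {α : Type*} [MeasurableSpace α] {μ : Measure α} {ρ : ℝ} (hρ : 0 ≤ ρ)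
    {F : α → ℝ≥0∞} (hF : Measurable F) (c : ℝ≥0∞) :
    powNorm ρ (fun x => c * F x) μ = c * powNorm ρ F μ := by
  unfold powNorm
  split_ifs with h0
  · exact essSup_const_mul
  · have h1 : ∀ x, (c * F x) ^ (1 / ρ) = c ^ (1 / ρ) * F x ^ (1 / ρ) := fun x =>
      ENNReal.mul_rpow_of_nonneg _ _ (by positivity)
    simp_rw [h1]
    rw [lintegral_const_mul _ (hF.pow_const _), ENNReal.mul_rpow_of_nonneg _ _ hρ,
      ← ENNReal.rpow_mul, one_div_mul_cancel h0, ENNReal.rpow_one]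

theorem powNorm_rpow {α : Type*} [MeasurableSpace α] {μ : Measure α} [IsProbabilityMeasure μ]
    {ρ : ℝ} (hρ : 0 ≤ ρ) {F : α → ℝ≥0∞} :
    powNorm ρ (fun x => F x ^ ρ) μ = (∫⁻ x, F x ∂μ) ^ ρ := by
  unfold powNorm
  split_ifs with h0
  · subst h0
    simp only [ENNReal.rpow_zero]
    exact essSup_const _ (IsProbabilityMeasure.ne_zero μ)
  · simp_rw [← ENNReal.rpow_mul, mul_one_div_cancel h0, ENNReal.rpow_one]

theorem rpow_sum_of_nonneg {ι : Type*} (s : Finset ι) (x : ℝ≥0∞) {e : ι → ℝ}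
    (he : ∀ i ∈ s, 0 ≤ e i) : x ^ ∑ i ∈ s, e i = ∏ i ∈ s, x ^ e i := by
  classical
  induction s using Finset.induction with
  | empty => simp
  | insert i s hi ih =>
    have h := fun j hj => he j (Finset.mem_insert_of_mem hj)
    rw [Finset.sum_insert hi, Finset.prod_insert hi,
      ENNReal.rpow_add_of_nonneg _ _ (he i (Finset.mem_insert_self _ _)) (Finset.sum_nonneg h),
      ih h]

/-- Hölder's inequality with several exponents, for a constant dominated by a monomial. -/
theorem le_mul_prod_lintegral_rpow {α ι : Type*} [MeasurableSpace α] {ν : Measure α}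
    [IsProbabilityMeasure ν] (s : Finset ι) {f : ι → α → ℝ≥0∞} (hf : ∀ i, Measurable (f i))
    {e : ι → ℝ} (he : ∀ i ∈ s, 0 ≤ e i) (hs : 0 < ∑ i ∈ s, e i) {Y M : ℝ≥0∞}
    (hY : ∀ᵐ y ∂ν, Y ≤ M * ∏ i ∈ s, f i y ^ e i) :
    Y ≤ M * ∏ i ∈ s, (∫⁻ y, f i y ∂ν) ^ e i := by
  set S := ∑ i ∈ s, e i with hS
  have hprod : ∀ F : ι → ℝ≥0∞, ∏ i ∈ s, F i ^ e i = (∏ i ∈ s, F i ^ (e i / S)) ^ S := by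
    intro F
    rw [← ENNReal.prod_rpow_of_nonneg hs.le]
    refine Finset.prod_congr rfl fun i _ => ?_
    rw [← ENNReal.rpow_mul, div_mul_cancel₀ _ hs.ne']
  have h1 : Y = powNorm S (fun _ => Y) ν := by
    have := powNorm_rpow (μ := ν) hs.le (F := fun _ => Y ^ S⁻¹)
    simp only [← ENNReal.rpow_mul, inv_mul_cancel₀ hs.ne', ENNReal.rpow_one] at this
    rw [this]
    simp [← ENNReal.rpow_mul, hs.ne']
  rw [h1]
  refine (powNorm_mono_ae hs.le hY).trans ?_
  rw [powNorm_const_mul hs.le (Finset.measurable_fun_prod _ fun i _ => (hf i).pow_const _)]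
  gcongr
  simp_rw [hprod]
  rw [powNorm_rpow hs.le]
  gcongr
  refine lintegral_prod_norm_pow_le s (fun i _ => (hf i).aemeasurable) ?_
    (fun i hi => div_nonneg (he i hi) hs.le)
  rw [← Finset.sum_div, div_self hs.ne']

/-- Decreasing one exponent at the cost of increasing others preserves a product of averages,
provided the function realizing the exchange is a simultaneous `A₁`-type majorant. -/
theorem prod_powNorm_le_rpow {α ι : Type*} [Fintype ι] [MeasurableSpace α] {ν : Measure α}
    [IsProbabilityMeasure ν] {τ d a : ι → ℝ} {γ Δ : ℝ} (hτ : ∀ k, 0 < τ k)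
    (hσ : ∀ k, 0 ≤ τ k + d k) (hd : ∑ k, d k = 0) (hγ : ∀ k, d k ≤ τ k * γ) (hγ0 : 0 < γ)
    (hΔ : Δ = ∑ k with 0 < d k, d k) (hΔ0 : 0 < Δ)
    (ha : ∀ k, a k = if 0 < d k then d k / (τ k + d k) else Δ / (Δ + τ k * γ))
    {g : α → ℝ≥0∞} (hg : Measurable g) (hg0 : ∀ x, g x ≠ 0) (hgt : ∀ x, g x ≠ ∞)
    {v : ι → α → ℝ≥0∞} (hv : ∀ k, Measurable (v k)) (hv0 : ∀ k x, v k x ≠ 0)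
    (hvt : ∀ k x, v k x ≠ ∞) (hv1 : ∀ x, ∏ k, v k x ^ τ k = 1) {U : ι → ℝ≥0∞}
    (hgU : ∀ k, ∀ᵐ x ∂ν, ∫⁻ y, g y ^ a k * v k y ^ (1 - a k) ∂ν ≤ (g x / v k x) ^ a k * U k)
    (hvU : ∀ k, ∫⁻ y, v k y ∂ν ≤ U k) :
    ∏ k, powNorm (τ k + d k) (fun x => v k x ^ τ k * g x ^ d k) ν ≤
      (∏ k, U k ^ τ k) ^ (1 + γ) := by
  classical
  set A : ι → ℝ≥0∞ := fun k => powNorm (τ k + d k) (fun x => v k x ^ τ k * g x ^ d k) ν with hA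
  set Y : ℝ≥0∞ := ∏ k with 0 < d k, A k with hYdef
  set E : ι → ℝ := fun k => τ k * γ - if 0 < d k then d k else 0 with hE
  have hE0 : ∀ k, 0 ≤ E k := by
    intro k
    simp only [hE]
    split_ifs
    · linarith [hγ k]
    · have := mul_pos (hτ k) hγ0; linarith
  have hYle : ∀ᵐ y ∂ν, Y ≤ (∏ k with 0 < d k, U k ^ (τ k + d k)) *
      (g y ^ Δ * ∏ k, v k y ^ E k) := by
    filter_upwards [ae_all_iff.2 hgU] with y hy
    have h1 : ∏ k, v k y ^ E k = ∏ k with 0 < d k, v k y ^ (-d k) := by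
      calc ∏ k, v k y ^ E k
          = ∏ k, (v k y ^ τ k) ^ γ * if 0 < d k then v k y ^ (-d k) else 1 := by
            refine Finset.prod_congr rfl fun k _ => ?_
            simp only [hE, sub_eq_add_neg]
            rw [ENNReal.rpow_add _ _ (hv0 k y) (hvt k y), ENNReal.rpow_mul]
            split_ifs <;> simp
        _ = _ := by
            rw [Finset.prod_mul_distrib, ENNReal.prod_rpow_of_nonneg hγ0.le, hv1,
              ENNReal.one_rpow, one_mul, Finset.prod_filter]
    have h2 : g y ^ Δ = ∏ k with 0 < d k, g y ^ d k := by
      rw [hΔ]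
      exact rpow_sum_of_nonneg _ _ fun k hk => (Finset.mem_filter.1 hk).2.le
    rw [h1, h2, ← Finset.prod_mul_distrib, ← Finset.prod_mul_distrib]
    refine Finset.prod_le_prod' fun k hk => ?_
    have hdk : 0 < d k := (Finset.mem_filter.1 hk).2
    have hσk : 0 < τ k + d k := add_pos (hτ k) hdk
    have hak : a k = d k / (τ k + d k) := by rw [ha, if_pos hdk]
    have hak1 : 1 - a k = τ k / (τ k + d k) := by rw [hak]; field_simp; ring
    have h3 : (fun x => v k x ^ τ k * g x ^ d k) =
        fun x => (g x ^ a k * v k x ^ (1 - a k)) ^ (τ k + d k) := by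
      ext x
      rw [ENNReal.mul_rpow_of_nonneg _ _ hσk.le, ← ENNReal.rpow_mul, ← ENNReal.rpow_mul, hak1, hak,
        div_mul_cancel₀ _ hσk.ne', div_mul_cancel₀ _ hσk.ne', mul_comm]
    simp only [hA]
    rw [h3, powNorm_rpow hσk.le]
    refine (ENNReal.rpow_le_rpow (hy k) hσk.le).trans_eq ?_
    rw [ENNReal.mul_rpow_of_nonneg _ _ hσk.le, ← ENNReal.rpow_mul, hak, div_mul_cancel₀ _ hσk.ne',
      ENNReal.div_rpow_of_nonneg _ _ hdk.le, ENNReal.rpow_neg, mul_comm, div_eq_mul_inv]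
  set L : ℝ≥0∞ := (∏ k with 0 < d k, U k ^ (τ k + d k)) * ∏ k, U k ^ E k with hL
  have hYj : ∀ j, ¬ 0 < d j → ∀ᵐ x ∂ν, Y ≤ L * (U j * (g x / v j x)) ^ Δ := by
    intro j hj
    have hEj : E j = τ j * γ := by simp [hE, hj]
    have hEj0 : 0 < E j := hEj ▸ mul_pos (hτ j) hγ0
    have haj : a j = Δ / (Δ + E j) := by rw [ha, if_neg hj, hEj]
    have haj1 : 1 - a j = E j / (Δ + E j) := by rw [haj]; field_simp; ring
    have hpos : 0 < Δ + E j := by positivity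
    set f : ι → α → ℝ≥0∞ := fun k =>
      if k = j then fun y => g y ^ a j * v j y ^ (1 - a j) else v k with hf
    set e : ι → ℝ := fun k => if k = j then Δ + E j else E k with he
    have he0 : ∀ k, 0 ≤ e k := by
      intro k
      simp only [he]
      split_ifs
      exacts [hpos.le, hE0 k]
    have hes : 0 < ∑ k, e k := by
      refine hpos.trans_le ?_
      have := Finset.single_le_sum (f := e) (fun k _ => he0 k) (Finset.mem_univ j)
      simpa [he] using this
    have hfm : ∀ k, Measurable (f k) := by
      intro k
      simp only [hf]
      split_ifs
      exacts [(hg.pow_const _).mul ((hv j).pow_const _), hv k]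
    have hfe : ∀ y, g y ^ Δ * ∏ k, v k y ^ E k = ∏ k, f k y ^ e k := by
      intro y
      have : ∀ k, f k y ^ e k = (if k = j then g y ^ Δ else 1) * v k y ^ E k := by
        intro k
        simp only [hf, he]
        split_ifs with hk
        · subst hk
          rw [ENNReal.mul_rpow_of_nonneg _ _ hpos.le, ← ENNReal.rpow_mul, ← ENNReal.rpow_mul,
            haj1, haj, div_mul_cancel₀ _ hpos.ne', div_mul_cancel₀ _ hpos.ne']
        · rw [one_mul]
      simp_rw [this, Finset.prod_mul_distrib]
      simp
    have hYf := le_mul_prod_lintegral_rpow Finset.univ hfm (fun k _ => he0 k) hes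
      (hYle.mono fun y hy => hy.trans_eq (by rw [hfe y]))
    filter_upwards [hgU j] with x hx
    refine hYf.trans ?_
    rw [hL, mul_assoc]
    gcongr
    calc ∏ k, (∫⁻ y, f k y ∂ν) ^ e k
        ≤ ∏ k, U k ^ E k * if k = j then (U j * (g x / v j x)) ^ Δ else 1 := by
          refine Finset.prod_le_prod' fun k _ => ?_
          simp only [hf, he]
          split_ifs with hk
          · subst hk
            refine (ENNReal.rpow_le_rpow hx hpos.le).trans_eq ?_
            rw [ENNReal.mul_rpow_of_nonneg _ _ hpos.le, ← ENNReal.rpow_mul, haj,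
              div_mul_cancel₀ _ hpos.ne', ENNReal.rpow_add_of_nonneg _ _ hΔ0.le hEj0.le,
              ENNReal.mul_rpow_of_nonneg _ _ hΔ0.le]
            ring
          · rw [mul_one]
            exact ENNReal.rpow_le_rpow (hvU k) (hE0 k)
      _ = _ := by rw [Finset.prod_mul_distrib]; simp
  have hAj : ∀ j, ¬ 0 < d j → Y ^ (-d j / Δ) * A j ≤ L ^ (-d j / Δ) * U j ^ τ j := by
    intro j hj
    have hdj : 0 ≤ -d j := by linarith
    have hdΔ : 0 ≤ -d j / Δ := div_nonneg hdj hΔ0.le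
    have hm : Measurable fun x => v j x ^ τ j * g x ^ d j :=
      ((hv j).pow_const _).mul (hg.pow_const _)
    have h1 : ∀ᵐ x ∂ν, Y ^ (-d j / Δ) * (v j x ^ τ j * g x ^ d j) ≤
        L ^ (-d j / Δ) * U j ^ (-d j) * v j x ^ (τ j + d j) := by
      filter_upwards [hYj j hj] with x hx
      calc Y ^ (-d j / Δ) * (v j x ^ τ j * g x ^ d j)
          ≤ (L * (U j * (g x / v j x)) ^ Δ) ^ (-d j / Δ) * (v j x ^ τ j * g x ^ d j) := by
            gcongr
        _ = L ^ (-d j / Δ) * U j ^ (-d j) * (v j x ^ τ j * (v j x ^ (-d j))⁻¹) *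
              (g x ^ (-d j) * g x ^ d j) := by
            rw [ENNReal.mul_rpow_of_nonneg _ _ hdΔ, ← ENNReal.rpow_mul, mul_div_cancel₀ _ hΔ0.ne',
              ENNReal.mul_rpow_of_nonneg _ _ hdj, ENNReal.div_rpow_of_nonneg _ _ hdj,
              div_eq_mul_inv (g x ^ _)]
            ring
        _ = _ := by
            rw [← ENNReal.rpow_neg, neg_neg, ← ENNReal.rpow_add _ _ (hv0 j x) (hvt j x),
              ← ENNReal.rpow_add _ _ (hg0 x) (hgt x), neg_add_cancel, ENNReal.rpow_zero, mul_one]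
    calc Y ^ (-d j / Δ) * A j
        = powNorm (τ j + d j) (fun x => Y ^ (-d j / Δ) * (v j x ^ τ j * g x ^ d j)) ν :=
          (powNorm_const_mul (hσ j) hm _).symm
      _ ≤ powNorm (τ j + d j)
            (fun x => L ^ (-d j / Δ) * U j ^ (-d j) * v j x ^ (τ j + d j)) ν :=
          powNorm_mono_ae (hσ j) h1
      _ = L ^ (-d j / Δ) * U j ^ (-d j) * (∫⁻ x, v j x ∂ν) ^ (τ j + d j) := by
          rw [powNorm_const_mul (hσ j) ((hv j).pow_const _), powNorm_rpow (hσ j)]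
      _ ≤ L ^ (-d j / Δ) * U j ^ (-d j) * U j ^ (τ j + d j) := by
          gcongr
          exacts [hσ j, hvU j]
      _ = _ := by
          rw [mul_assoc, ← ENNReal.rpow_add_of_nonneg _ _ hdj (hσ j)]
          congr 2; ring
  have hsum : ∑ k with ¬ 0 < d k, -d k / Δ = 1 := by
    have := Finset.sum_filter_add_sum_filter_not Finset.univ (fun k => 0 < d k) d
    rw [hd, ← hΔ] at this
    rw [← Finset.sum_div, Finset.sum_neg_distrib, div_eq_one_iff_eq hΔ0.ne']
    linarith
  have hpow : ∀ Z : ℝ≥0∞, Z = ∏ k with ¬ 0 < d k, Z ^ (-d k / Δ) := by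
    intro Z
    rw [← rpow_sum_of_nonneg, hsum, ENNReal.rpow_one]
    intro k hk
    have := (Finset.mem_filter.1 hk).2
    exact div_nonneg (by linarith) hΔ0.le
  calc ∏ k, A k = Y * ∏ k with ¬ 0 < d k, A k :=
        (Finset.prod_filter_mul_prod_filter_not _ _ _).symm
    _ = ∏ k with ¬ 0 < d k, Y ^ (-d k / Δ) * A k := by
        rw [Finset.prod_mul_distrib, ← hpow]
    _ ≤ ∏ k with ¬ 0 < d k, L ^ (-d k / Δ) * U k ^ τ k :=
        Finset.prod_le_prod' fun k hk => hAj k (Finset.mem_filter.1 hk).2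
    _ = L * ∏ k with ¬ 0 < d k, U k ^ τ k := by
        rw [Finset.prod_mul_distrib, ← hpow]
    _ = ∏ k, U k ^ τ k * (U k ^ τ k) ^ γ := by
        rw [hL, Finset.prod_filter, Finset.prod_filter, ← Finset.prod_mul_distrib,
          ← Finset.prod_mul_distrib]
        refine Finset.prod_congr rfl fun k _ => ?_
        have hEk := hE0 k
        simp only [hE] at hEk ⊢
        rw [← ENNReal.rpow_mul]
        by_cases hk : 0 < d k
        · simp only [hk, if_true, not_true, if_false, mul_one] at hEk ⊢
          rw [← ENNReal.rpow_add_of_nonneg _ _ (hσ k) hEk,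
            ← ENNReal.rpow_add_of_nonneg _ _ (hτ k).le (mul_pos (hτ k) hγ0).le]
          congr 1; ring
        · simp only [hk, if_false, not_false_eq_true, if_true, one_mul, sub_zero]
          rw [mul_comm]
    _ = _ := by
        rw [Finset.prod_mul_distrib, ENNReal.prod_rpow_of_nonneg hγ0.le,
          ENNReal.rpow_add_of_nonneg _ _ zero_le_one hγ0.le, ENNReal.rpow_one]

theorem wnorm_eq_powNorm {n : ℕ} {ρ : ℝ} (hρ : 0 ≤ ρ) (f w : (Fin n → ℝ) → ℝ) :
    wnorm ρ f w = powNorm ρ (fun x => ENNReal.ofReal |f x * w x|) volume := by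
  unfold wnorm powNorm expOf
  have h : ∀ x, ‖f x * w x‖ₑ = ENNReal.ofReal |f x * w x| := fun x => by
    rw [Real.enorm_eq_ofReal_abs]
  split_ifs with h0
  · rw [eLpNorm_exponent_top, eLpNormEssSup]
    simp_rw [h]
  · have hρ' : 0 < 1 / ρ := one_div_pos.2 (hρ.lt_of_ne' h0)
    rw [eLpNorm_eq_lintegral_rpow_enorm_toReal (by simpa using hρ') ofReal_ne_top,
      ENNReal.toReal_ofReal hρ'.le, one_div_one_div]
    simp_rw [h]

theorem avg_eq_powNorm {n : ℕ} (τ : ℝ) (f : (Fin n → ℝ) → ℝ) {Q : Set (Fin n → ℝ)}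
    (hQ : volume Q ≠ ∞) :
    avg τ f Q = powNorm τ (fun x => ENNReal.ofReal |f x|) ((volume Q)⁻¹ • volume.restrict Q) := by
  unfold avg powNorm
  split_ifs with h0
  · rw [essSup_ennreal_smul_measure (ENNReal.inv_ne_zero.2 hQ)]
  · rw [lintegral_smul_measure, smul_eq_mul]

theorem powNorm_rpow_le {α : Type*} [MeasurableSpace α] {μ : Measure α} {ρ : ℝ}
    (F : α → ℝ≥0∞) : powNorm ρ (fun x => F x ^ ρ) μ ≤ (∫⁻ x, F x ∂μ) ^ ρ := by
  unfold powNorm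
  split_ifs with h0
  · subst h0
    simp only [ENNReal.rpow_zero]
    exact essSup_le_of_ae_le _ (Filter.Eventually.of_forall fun _ => le_rfl)
  · simp_rw [← ENNReal.rpow_mul, mul_one_div_cancel h0, ENNReal.rpow_one]
    exact le_rfl

theorem powNorm_mul_rpow_le {α : Type*} [MeasurableSpace α] {μ : Measure α} {ρ ε : ℝ}
    (hρ : 0 ≤ ρ) (hε : 0 ≤ ε) {F g : α → ℝ≥0∞} (hF : Measurable F) (hg : Measurable g) :
    powNorm (ρ + ε) (fun x => F x * g x ^ ε) μ ≤ powNorm ρ F μ * (∫⁻ x, g x ∂μ) ^ ε := by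
  rcases hε.eq_or_lt with rfl | hε
  · simp
  rcases hρ.eq_or_lt with rfl | hρ
  · rw [zero_add]
    have h : ∀ᵐ x ∂μ, F x * g x ^ ε ≤ powNorm 0 F μ * g x ^ ε := by
      filter_upwards [ENNReal.ae_le_essSup F] with x hx
      simp only [powNorm, if_true]
      gcongr
    refine (powNorm_mono_ae hε.le h).trans ?_
    rw [powNorm_const_mul hε.le (hg.pow_const _)]
    gcongr
    exact powNorm_rpow_le g
  · have hs : 0 < ρ + ε := by positivity
    unfold powNorm
    rw [if_neg hs.ne', if_neg hρ.ne']
    have h : ∀ x, (F x * g x ^ ε) ^ (1 / (ρ + ε)) =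
        (F x ^ (1 / ρ)) ^ (ρ / (ρ + ε)) * g x ^ (ε / (ρ + ε)) := by
      intro x
      rw [ENNReal.mul_rpow_of_nonneg _ _ (by positivity), ← ENNReal.rpow_mul, ← ENNReal.rpow_mul]
      congr 2 <;> field_simp
    simp_rw [h]
    refine (ENNReal.rpow_le_rpow (lintegral_mul_norm_pow_le (hF.pow_const _).aemeasurable
      hg.aemeasurable (by positivity) (by positivity) (by field_simp)) hs.le).trans_eq ?_
    rw [ENNReal.mul_rpow_of_nonneg _ _ hs.le, ← ENNReal.rpow_mul, ← ENNReal.rpow_mul,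
      div_mul_cancel₀ _ hs.ne', div_mul_cancel₀ _ hs.ne']

theorem lintegral_div_powNorm_rpow_le_one {α : Type*} [MeasurableSpace α] {μ : Measure α} {ρ : ℝ}
    (hρ : 0 < ρ) {F : α → ℝ≥0∞} (hF : Measurable F) :
    ∫⁻ x, (F x / powNorm ρ F μ) ^ (1 / ρ) ∂μ ≤ 1 := by
  have h : powNorm ρ F μ ^ (1 / ρ) = ∫⁻ x, F x ^ (1 / ρ) ∂μ := by
    unfold powNorm
    rw [if_neg hρ.ne', ← ENNReal.rpow_mul, mul_one_div_cancel hρ.ne', ENNReal.rpow_one]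
  have h1 : ∀ x, (F x / powNorm ρ F μ) ^ (1 / ρ) =
      F x ^ (1 / ρ) * (∫⁻ x, F x ^ (1 / ρ) ∂μ)⁻¹ := by
    intro x
    rw [ENNReal.div_rpow_of_nonneg _ _ (by positivity), h, div_eq_mul_inv]
  simp_rw [h1]
  rw [lintegral_mul_const _ (hF.pow_const _), ← div_eq_mul_inv]
  exact ENNReal.div_self_le_one

theorem ae_le_powNorm_mul_rpow {α : Type*} [MeasurableSpace α] {μ : Measure α} {ρ : ℝ}
    (hρ : 0 < ρ) {F g : α → ℝ≥0∞} (hF : Measurable F) (hFt : powNorm ρ F μ ≠ ∞)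
    (h : ∀ᵐ x ∂μ, (F x / powNorm ρ F μ) ^ (1 / ρ) ≤ g x) :
    ∀ᵐ x ∂μ, F x ≤ powNorm ρ F μ * g x ^ ρ := by
  by_cases h0 : powNorm ρ F μ = 0
  · have h1 : ∫⁻ x, F x ^ (1 / ρ) ∂μ = 0 := by
      unfold powNorm at h0
      rw [if_neg hρ.ne'] at h0
      rcases ENNReal.rpow_eq_zero_iff.1 h0 with h0 | h0
      exacts [h0.1, absurd h0.2 hρ.not_gt]
    filter_upwards [(lintegral_eq_zero_iff (hF.pow_const _)).1 h1] with x hx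
    have : F x = 0 := by
      rcases ENNReal.rpow_eq_zero_iff.1 hx with h0 | h0
      exacts [h0.1, absurd h0.2 (by positivity : 0 < 1 / ρ).not_gt]
    simp [this]
  · filter_upwards [h] with x hx
    rw [one_div, ENNReal.rpow_inv_le_iff hρ] at hx
    rw [mul_comm]
    exact (ENNReal.div_le_iff h0 hFt).1 hx

/-- The change of exponents in a product of norms, using a common majorant of the functions whose
exponents increase. -/
theorem prod_powNorm_le_mul_prod {α ι : Type*} [Fintype ι] [MeasurableSpace α] {μ : Measure α}
    {p q : ι → ℝ} (hp : ∀ k, 0 ≤ p k) (hq : ∀ k, 0 ≤ q k)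
    (hqs : ∑ k, q k = 1) {F : ι → α → ℝ≥0∞} (hF : ∀ k, Measurable (F k))
    (hFt : ∀ k, powNorm (p k) (F k) μ ≠ ∞) {g : α → ℝ≥0∞} (hg : Measurable g)
    (hg0 : ∀ x, g x ≠ 0) (hgt : ∀ x, g x ≠ ∞)
    (hFg : ∀ k, q k < p k → ∀ᵐ x ∂μ, (F k x / powNorm (p k) (F k) μ) ^ (1 / p k) ≤ g x)
    {B : ℝ≥0∞} (hB : 1 ≤ B) (hgB : ∫⁻ x, g x ∂μ ≤ B) :
    ∏ k, powNorm (q k) (fun x => F k x * g x ^ (q k - p k)) μ ≤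
      B * ∏ k, powNorm (p k) (F k) μ := by
  classical
  set c : ι → ℝ := fun k => if q k < p k then q k else q k - p k with hc
  have hc0 : ∀ k, 0 ≤ c k := by
    intro k
    simp only [hc]
    split_ifs with h
    exacts [hq k, by linarith]
  have hcs : ∑ k, c k ≤ 1 := by
    have h1 : ∀ k, c k + p k = q k + if q k < p k then p k else 0 := by
      intro k
      simp only [hc]
      split_ifs <;> ring
    have h2 : ∑ k, c k + ∑ k, p k = ∑ k, q k + ∑ k, if q k < p k then p k else 0 := by
      rw [← Finset.sum_add_distrib, ← Finset.sum_add_distrib]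
      exact Finset.sum_congr rfl fun k _ => h1 k
    have h3 : (∑ k, if q k < p k then p k else 0) ≤ ∑ k, p k := by
      refine Finset.sum_le_sum fun k _ => ?_
      split_ifs
      exacts [le_rfl, hp k]
    linarith
  have hk : ∀ k, powNorm (q k) (fun x => F k x * g x ^ (q k - p k)) μ ≤
      B ^ c k * powNorm (p k) (F k) μ := by
    intro k
    rw [mul_comm]
    by_cases h : q k < p k
    · have hpk : 0 < p k := (hq k).trans_lt h
      have h1 : ∀ᵐ x ∂μ, F k x * g x ^ (q k - p k) ≤ powNorm (p k) (F k) μ * g x ^ q k := by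
        filter_upwards [ae_le_powNorm_mul_rpow hpk (hF k) (hFt k) (hFg k h)] with x hx
        calc F k x * g x ^ (q k - p k)
            ≤ powNorm (p k) (F k) μ * g x ^ p k * g x ^ (q k - p k) := by gcongr
          _ = _ := by
            rw [mul_assoc, ← ENNReal.rpow_add _ _ (hg0 x) (hgt x), add_sub_cancel]
      refine (powNorm_mono_ae (hq k) h1).trans ?_
      rw [powNorm_const_mul (hq k) (hg.pow_const _)]
      gcongr
      refine (powNorm_rpow_le g).trans ?_
      simp only [hc, h, if_true]
      exact ENNReal.rpow_le_rpow hgB (hq k)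
    · have h1 := powNorm_mul_rpow_le (μ := μ) (hp k) (sub_nonneg.2 (not_lt.1 h)) (hF k) hg
      rw [add_sub_cancel] at h1
      refine h1.trans ?_
      gcongr
      simp only [hc, h, if_false]
      exact ENNReal.rpow_le_rpow hgB (sub_nonneg.2 (not_lt.1 h))
  calc _ ≤ ∏ k, B ^ c k * powNorm (p k) (F k) μ := Finset.prod_le_prod' fun k _ => hk k
    _ = B ^ (∑ k, c k) * ∏ k, powNorm (p k) (F k) μ := by
        rw [Finset.prod_mul_distrib, rpow_sum_of_nonneg _ _ fun k _ => hc0 k]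
    _ ≤ B ^ (1 : ℝ) * ∏ k, powNorm (p k) (F k) μ := by
        gcongr
    _ = _ := by rw [ENNReal.rpow_one]

/-- A positive function majorizing the normalized powers of the functions `F k`, `k ∈ s`. -/
theorem exists_majorant_normalized {n : ℕ} {ι : Type*} (s : Finset ι) {p : ι → ℝ}
    (hp : ∀ k ∈ s, 0 < p k) {F : ι → (Fin n → ℝ) → ℝ≥0∞} (hF : ∀ k, Measurable (F k)) :
    ∃ G₀ : (Fin n → ℝ) → ℝ≥0∞, Measurable G₀ ∧ (∀ x, G₀ x ≠ 0) ∧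
      ∫⁻ x, G₀ x ≤ s.card + 3⁻¹ ∧
      ∀ k ∈ s, ∀ x, (F k x / powNorm (p k) (F k) volume) ^ (1 / p k) ≤ G₀ x := by
  obtain ⟨φ, hφ0, hφm, hφ⟩ := exists_pos_lintegral_lt_of_sigmaFinite
    (volume : Measure (Fin n → ℝ)) (ε := 3⁻¹) (by norm_num)
  have hm : ∀ k, Measurable fun x => (F k x / powNorm (p k) (F k) volume) ^ (1 / p k) :=
    fun k => ((hF k).div_const _).pow_const _
  refine ⟨fun x => ∑ k ∈ s, (F k x / powNorm (p k) (F k) volume) ^ (1 / p k) + φ x,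
    (Finset.measurable_fun_sum _ fun k _ => hm k).add hφm.coe_nnreal_ennreal, fun x => ?_, ?_,
    fun k hk x => ?_⟩
  · have := (hφ0 x).ne'
    simp [this]
  · rw [lintegral_add_right _ hφm.coe_nnreal_ennreal, lintegral_finsetSum _ fun k _ => hm k]
    gcongr
    calc _ ≤ ∑ k ∈ s, (1 : ℝ≥0∞) := Finset.sum_le_sum fun k hk =>
          lintegral_div_powNorm_rpow_le_one (hp k hk) (hF k)
      _ = _ := by simp
  · exact (Finset.single_le_sum
      (f := fun k => (F k x / powNorm (p k) (F k) volume) ^ (1 / p k))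
      (fun _ _ => zero_le) hk).trans le_self_add

theorem three_halves_mul_add_le_two_pow_sq {m k : ℕ} (hk : k ≤ m) (hm : 1 ≤ m) :
    3 / 2 * ((k : ℝ≥0∞) + 3⁻¹) ≤ 2 ^ m ^ 2 := by
  have h1 : 3 * k + 1 ≤ 2 * 2 ^ m ^ 2 := by
    have := (m ^ 2).lt_two_pow_self
    nlinarith
  have h2 : (3 : ℝ≥0∞) * k + 1 ≤ 2 * 2 ^ m ^ 2 := by exact_mod_cast h1
  have h3 : 3 / 2 * ((k : ℝ≥0∞) + 3⁻¹) = (3 * k + 1) / 2 := by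
    rw [div_eq_mul_inv, div_eq_mul_inv, mul_right_comm, mul_add,
      ENNReal.mul_inv_cancel (by norm_num) (by norm_num)]
  rw [h3]
  exact ENNReal.div_le_of_le_mul' h2

theorem IsCube.volume_ne_zero {n : ℕ} {Q : Set (Fin n → ℝ)} (hQ : IsCube Q) : volume Q ≠ 0 := by
  obtain ⟨c, h, hh, rfl⟩ := hQ
  rw [volume_pi_Ico_add]
  exact pow_ne_zero _ (by simpa using hh)

theorem IsCube.volume_ne_top {n : ℕ} {Q : Set (Fin n → ℝ)} (hQ : IsCube Q) : volume Q ≠ ∞ := by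
  obtain ⟨c, h, hh, rfl⟩ := hQ
  rw [volume_pi_Ico_add]
  finiteness

theorem IsCube.isProbabilityMeasure {n : ℕ} {Q : Set (Fin n → ℝ)} (hQ : IsCube Q) :
    IsProbabilityMeasure ((volume Q)⁻¹ • volume.restrict Q) :=
  ⟨by simp [ENNReal.inv_mul_cancel hQ.volume_ne_zero hQ.volume_ne_top]⟩

/-- The density `w⁻¹ ^ (1 / τ)` whose averages appear in the weight constant. -/
def dualWeight {n : ℕ} (τ : ℝ) (w : (Fin n → ℝ) → ℝ) (x : Fin n → ℝ) : ℝ≥0∞ :=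
  ENNReal.ofReal (w x)⁻¹ ^ (1 / τ)

section dualWeight

variable {n : ℕ} {τ : ℝ} {w : (Fin n → ℝ) → ℝ}

theorem measurable_dualWeight (hw : IsWeight w) : Measurable (dualWeight τ w) :=
  hw.1.inv.ennreal_ofReal.pow_const _

theorem dualWeight_ne_zero (hw : IsWeight w) (x : Fin n → ℝ) : dualWeight τ w x ≠ 0 :=
  (ENNReal.rpow_pos (by simpa using hw.2 x) ofReal_ne_top).ne'

theorem dualWeight_ne_top (hw : IsWeight w) (x : Fin n → ℝ) : dualWeight τ w x ≠ ∞ :=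
  ENNReal.rpow_ne_top_of_ne_zero (by simpa using hw.2 x) ofReal_ne_top

theorem dualWeight_rpow (hτ : τ ≠ 0) (x : Fin n → ℝ) :
    dualWeight τ w x ^ τ = ENNReal.ofReal (w x)⁻¹ := by
  rw [dualWeight, ← ENNReal.rpow_mul, one_div_mul_cancel hτ, ENNReal.rpow_one]

theorem avg_inv_eq_rpow (hτ : τ ≠ 0) (hw : IsWeight w) (Q : Set (Fin n → ℝ)) :
    avg τ (fun x => (w x)⁻¹) Q = ((volume Q)⁻¹ * ∫⁻ x in Q, dualWeight τ w x) ^ τ := by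
  have h : ∀ x, |(w x)⁻¹| = (w x)⁻¹ := fun x => abs_of_pos (inv_pos.2 (hw.2 x))
  simp only [avg, if_neg hτ, h, dualWeight]

theorem average_dualWeight_ne_zero (hw : IsWeight w) {Q : Set (Fin n → ℝ)} (hQ : IsCube Q) :
    (volume Q)⁻¹ * ∫⁻ x in Q, dualWeight τ w x ≠ 0 := by
  refine mul_ne_zero (ENNReal.inv_ne_zero.2 hQ.volume_ne_top) ?_
  rw [Ne, lintegral_eq_zero_iff (measurable_dualWeight hw)]
  intro h
  have h1 : ∀ᵐ _ ∂(volume.restrict Q), False := h.mono fun x hx => dualWeight_ne_zero hw x hx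
  rw [Filter.eventually_false_iff_eq_bot, ae_eq_bot, Measure.restrict_eq_zero] at h1
  exact hQ.volume_ne_zero h1

end dualWeight

theorem prod_average_dualWeight_le {n m : ℕ} {rinv pinv : Fin m → ℝ}
    (hpr : ∀ j, pinv j < rinv j) {w : Fin m → (Fin n → ℝ) → ℝ} (hw : ∀ j, IsWeight (w j))
    {Q : Set (Fin n → ℝ)} (hQ : IsCube Q) :
    ∏ j, ((volume Q)⁻¹ * ∫⁻ x in Q, dualWeight (rinv j - pinv j) (w j) x) ^ (rinv j - pinv j) ≤
      wConstS rinv pinv w := by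
  simp_rw [← avg_inv_eq_rpow (sub_pos.2 (hpr _)).ne' (hw _)]
  exact le_iSup (fun Q : {Q : Set (Fin n → ℝ) // IsCube Q} =>
    ∏ j, avg (rinv j - pinv j) (fun x => (w j x)⁻¹) Q.1) ⟨Q, hQ⟩

theorem setLIntegral_dualWeight_ne_top {n m : ℕ} {rinv pinv : Fin m → ℝ}
    (hpr : ∀ j, pinv j < rinv j) {w : Fin m → (Fin n → ℝ) → ℝ} (hw : ∀ j, IsWeight (w j))
    (hfin : wConstS rinv pinv w < ∞) {Q : Set (Fin n → ℝ)} (hQ : IsCube Q) (j : Fin m) :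
    ∫⁻ x in Q, dualWeight (rinv j - pinv j) (w j) x ≠ ∞ := by
  intro htop
  refine ((prod_average_dualWeight_le hpr hw hQ).trans_lt hfin).ne ?_
  rw [← Finset.mul_prod_erase _ _ (Finset.mem_univ j), htop,
    ENNReal.mul_top (ENNReal.inv_ne_zero.2 hQ.volume_ne_top),
    ENNReal.top_rpow_of_pos (sub_pos.2 (hpr j)), ENNReal.top_mul]
  refine Finset.prod_ne_zero_iff.2 fun k _ h0 => ?_
  rcases ENNReal.rpow_eq_zero_iff.1 h0 with h0 | h0
  exacts [average_dualWeight_ne_zero (hw k) hQ h0.1, (h0.2.trans (sub_pos.2 (hpr k))).false]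

/-- The weight constant of the modified weights `w k * G ^ (qinv k - pinv k)`, for `G` a
simultaneous majorant of `A₁` type. -/
theorem wConstS_mul_rpow_le {n m : ℕ} {rinv pinv qinv a : Fin m → ℝ} {γ : ℝ}
    (hpr : ∀ j, pinv j < rinv j) (hqr : ∀ j, qinv j ≤ rinv j)
    (hsum : ∑ j, (pinv j - qinv j) = 0) (hγ : ∀ j, pinv j - qinv j ≤ (rinv j - pinv j) * γ)
    (hγ0 : 0 < γ) (hΔ : 0 < ∑ j with 0 < pinv j - qinv j, (pinv j - qinv j))
    (ha : ∀ k, a k = if 0 < pinv k - qinv k then (pinv k - qinv k) / (rinv k - qinv k) else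
      (∑ j with 0 < pinv j - qinv j, (pinv j - qinv j)) /
        ((∑ j with 0 < pinv j - qinv j, (pinv j - qinv j)) + (rinv k - pinv k) * γ))
    {w : Fin m → (Fin n → ℝ) → ℝ} (hw : ∀ j, IsWeight (w j)) (hw1 : ∀ x, ∏ j, w j x = 1)
    {G : (Fin n → ℝ) → ℝ} (hG : Measurable G) (hG0 : ∀ x, 0 < G x) {D : ℝ≥0∞}
    (hGD : ∀ Q, IsCube Q → ∃ Q', IsCube Q' ∧ ∀ k,
      (volume Q)⁻¹ * ∫⁻ y in Q, dualWeight (rinv k - pinv k) (w k) y ≤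
        D * ((volume Q')⁻¹ * ∫⁻ y in Q', dualWeight (rinv k - pinv k) (w k) y) ∧
      ∀ᵐ x ∂(volume.restrict Q),
        (volume Q)⁻¹ * ∫⁻ y in Q, ENNReal.ofReal (G y) ^ a k *
            dualWeight (rinv k - pinv k) (w k) y ^ (1 - a k) ≤
          (ENNReal.ofReal (G x) / dualWeight (rinv k - pinv k) (w k) x) ^ a k *
            (D * ((volume Q')⁻¹ * ∫⁻ y in Q', dualWeight (rinv k - pinv k) (w k) y))) :
    wConstS rinv qinv (fun k x => w k x * G x ^ (qinv k - pinv k)) ≤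
      (D ^ ∑ k, (rinv k - pinv k)) ^ (1 + γ) * wConstS rinv pinv w ^ (1 + γ) := by
  refine iSup_le fun ⟨Q, hQ⟩ => ?_
  obtain ⟨Q', hQ', hk⟩ := hGD Q hQ
  have := hQ.isProbabilityMeasure
  have hτ : ∀ k, 0 < rinv k - pinv k := fun k => sub_pos.2 (hpr k)
  have hσ : ∀ k, rinv k - pinv k + (pinv k - qinv k) = rinv k - qinv k := fun k => by ring
  have hac : ∀ {P : (Fin n → ℝ) → Prop}, (∀ᵐ x ∂(volume.restrict Q), P x) →
      ∀ᵐ x ∂((volume Q)⁻¹ • volume.restrict Q), P x := fun h =>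
    Measure.ae_smul_measure h _
  have key := prod_powNorm_le_rpow (ν := (volume Q)⁻¹ • volume.restrict Q)
    (τ := fun k => rinv k - pinv k) (d := fun k => pinv k - qinv k) (a := a) hτ
    (fun k => (hσ k).symm ▸ sub_nonneg.2 (hqr k)) hsum hγ hγ0 rfl hΔ
    (fun k => by simp only [ha, hσ]) hG.ennreal_ofReal (fun x => by simpa using hG0 x)
    (fun x => ofReal_ne_top) (v := fun k => dualWeight (rinv k - pinv k) (w k))
    (fun k => measurable_dualWeight (hw k)) (fun k => dualWeight_ne_zero (hw k))
    (fun k => dualWeight_ne_top (hw k)) (fun x => by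
      simp_rw [dualWeight_rpow (hτ _).ne']
      rw [← ENNReal.ofReal_prod_of_nonneg fun k _ => (inv_pos.2 ((hw k).2 x)).le,
        Finset.prod_inv_distrib, hw1, inv_one, ofReal_one])
    (U := fun k => D * ((volume Q')⁻¹ * ∫⁻ y in Q', dualWeight (rinv k - pinv k) (w k) y))
    (fun k => by
      simp_rw [lintegral_smul_measure, smul_eq_mul]
      exact hac (hk k).2)
    (fun k => by
      simp_rw [lintegral_smul_measure, smul_eq_mul]
      exact (hk k).1)
  have hγ1 : 0 ≤ 1 + γ := by positivity
  calc ∏ k, avg (rinv k - qinv k) (fun x => (w k x * G x ^ (qinv k - pinv k))⁻¹) Q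
      = ∏ k, powNorm (rinv k - pinv k + (pinv k - qinv k))
          (fun x => dualWeight (rinv k - pinv k) (w k) x ^ (rinv k - pinv k) *
            ENNReal.ofReal (G x) ^ (pinv k - qinv k)) ((volume Q)⁻¹ • volume.restrict Q) := by
        refine Finset.prod_congr rfl fun k _ => ?_
        rw [avg_eq_powNorm _ _ hQ.volume_ne_top, hσ]
        congr 1
        ext x
        have hwx := (hw k).2 x
        have hGx := Real.rpow_pos_of_pos (hG0 x) (pinv k - qinv k)
        rw [dualWeight_rpow (hτ k).ne', ENNReal.ofReal_rpow_of_pos (hG0 x),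
          ← ENNReal.ofReal_mul (inv_pos.2 hwx).le, mul_inv, ← Real.rpow_neg (hG0 x).le, neg_sub,
          abs_of_pos (mul_pos (inv_pos.2 hwx) hGx)]
    _ ≤ _ := key
    _ ≤ (D ^ (∑ k, (rinv k - pinv k)) * wConstS rinv pinv w) ^ (1 + γ) := by
        refine ENNReal.rpow_le_rpow ?_ hγ1
        rw [rpow_sum_of_nonneg _ _ fun k _ => (hτ k).le]
        simp_rw [ENNReal.mul_rpow_of_nonneg D _ (hτ _).le]
        rw [Finset.prod_mul_distrib]
        gcongr
        exact prod_average_dualWeight_le hpr hw hQ'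
    _ = _ := ENNReal.mul_rpow_of_nonneg _ _ hγ1

/-- **Multilinear Rubio de Francia weight construction** (Theorem 3.1).
Given `1/r_j ∈ (0,1]`, `1/p_j ∈ [0,1]` with `1/p_j < 1/r_j` and `∑_j 1/p_j = 1`,
weights with `∏_j w_j = 1` and finite symmetric constant, functions `f_j ∈ L^{p_j}(w_j^{p_j})`,
and exponents `1/q_j ∈ [0,1]` with `1/q_j ≤ 1/r_j`, `∑_j 1/q_j = 1`, there exist weights
`W_j` with `∏_j W_j = 1` satisfying the two stated estimates, with a constant `C` depending
only on the exponents and the dimension. -/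
theorem multilinear_rubio_de_francia_weights
    (n m : ℕ) (rinv pinv qinv : Fin (m + 1) → ℝ)
    (hr0 : ∀ j, 0 < rinv j) (hr1 : ∀ j, rinv j ≤ 1)
    (hp0 : ∀ j, 0 ≤ pinv j) (hp1 : ∀ j, pinv j ≤ 1)
    (hpr : ∀ j, pinv j < rinv j) (hpsum : ∑ j, pinv j = 1)
    (hq0 : ∀ j, 0 ≤ qinv j) (hq1 : ∀ j, qinv j ≤ 1)
    (hqr : ∀ j, qinv j ≤ rinv j) (hqsum : ∑ j, qinv j = 1) :
    ∃ C : ℝ≥0∞, 0 < C ∧ C < ∞ ∧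
      ∀ w : Fin (m + 1) → (Fin n → ℝ) → ℝ, (∀ j, IsWeight (w j)) →
        (∀ x, ∏ j, w j x = 1) → wConstS rinv pinv w < ∞ →
      ∀ f : Fin (m + 1) → (Fin n → ℝ) → ℝ, (∀ j, Measurable (f j)) →
        (∀ j, wnorm (pinv j) (f j) (w j) < ∞) →
      ∃ W : Fin (m + 1) → (Fin n → ℝ) → ℝ,
        (∀ j, IsWeight (W j)) ∧ (∀ x, ∏ j, W j x = 1) ∧
        (∏ j, wnorm (qinv j) (f j) (W j)) ≤
          (2 : ℝ≥0∞) ^ (m ^ 2) * ∏ j, wnorm (pinv j) (f j) (w j) ∧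
        wConstS rinv qinv W ≤
          C * wConstS rinv pinv w ^
            (Finset.univ.sup' ⟨0, Finset.mem_univ 0⟩ fun j =>
              (rinv j - qinv j) / (rinv j - pinv j)) := by
  have hτ : ∀ k, 0 < rinv k - pinv k := fun k => sub_pos.2 (hpr k)
  have hsum : ∑ j, (pinv j - qinv j) = 0 := by rw [Finset.sum_sub_distrib, hpsum, hqsum, sub_self]
  by_cases hI : ∃ i, 0 < pinv i - qinv i
  swap
  · have heq : qinv = pinv := by
      push Not at hI
      have := (Finset.sum_eq_zero_iff_of_nonpos fun j _ => hI j).1 hsum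
      exact funext fun j => (sub_eq_zero.1 (this j (Finset.mem_univ j))).symm
    subst heq
    refine ⟨1, one_pos, one_lt_top, fun w hw hw1 _ f _ _ => ⟨w, hw, hw1, ?_, ?_⟩⟩
    · exact le_mul_of_one_le_left' (one_le_pow_of_one_le' (by norm_num) _)
    · have hs : (Finset.univ.sup' ⟨0, Finset.mem_univ 0⟩ fun j =>
          (rinv j - qinv j) / (rinv j - qinv j)) = 1 := by
        simp_rw [fun j => div_self (hτ j).ne']
        exact Finset.sup'_const _ _
      rw [hs, ENNReal.rpow_one, one_mul]
  obtain ⟨i, hi⟩ := hI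
  set s := Finset.univ.sup' ⟨0, Finset.mem_univ 0⟩ fun j =>
    (rinv j - qinv j) / (rinv j - pinv j) with hs
  have hγ : ∀ j, pinv j - qinv j ≤ (rinv j - pinv j) * (s - 1) := by
    intro j
    have h1 : (rinv j - qinv j) / (rinv j - pinv j) ≤ s :=
      Finset.le_sup' (fun j => (rinv j - qinv j) / (rinv j - pinv j)) (Finset.mem_univ j)
    rw [div_le_iff₀ (hτ j)] at h1
    linarith
  have hγ0 : 0 < s - 1 := pos_of_mul_pos_right (hi.trans_le (hγ i)) (hτ i).le
  set I : Finset (Fin (m + 1)) := Finset.univ.filter fun j => 0 < pinv j - qinv j with hIdef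
  have hiI : i ∈ I := by simpa [hIdef] using hi
  have hΔ : 0 < ∑ j ∈ I, (pinv j - qinv j) :=
    Finset.sum_pos (fun j hj => (Finset.mem_filter.1 hj).2) ⟨i, hiI⟩
  have hIcard : I.card ≤ m := by
    have hlt : I.card < (Finset.univ : Finset (Fin (m + 1))).card := by
      refine Finset.card_lt_card (Finset.filter_ssubset.2 ?_)
      by_contra! hcon
      exact (Finset.sum_pos (fun j hj => hcon j hj) ⟨i, Finset.mem_univ i⟩).ne' hsum
    rw [Finset.card_fin] at hlt
    omega
  have hm : 1 ≤ m := (Finset.card_pos.2 ⟨i, hiI⟩).trans_le hIcard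
  set a : Fin (m + 1) → ℝ := fun k =>
    if 0 < pinv k - qinv k then (pinv k - qinv k) / (rinv k - qinv k) else
      (∑ j ∈ I, (pinv j - qinv j)) /
        ((∑ j ∈ I, (pinv j - qinv j)) + (rinv k - pinv k) * (s - 1)) with ha
  have ha0 : ∀ k, 0 < a k := by
    intro k
    have := mul_pos (hτ k) hγ0
    simp only [ha]
    split_ifs with h
    · exact div_pos h (by linarith [hτ k])
    · positivity
  have ha1 : ∀ k, a k < 1 := by
    intro k
    have := mul_pos (hτ k) hγ0
    simp only [ha]
    split_ifs with h
    · rw [div_lt_one (by linarith [hτ k])]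
      linarith [hτ k]
    · rw [div_lt_one (by positivity)]
      linarith
  obtain ⟨D, hD1, hDt, hD⟩ := exists_majorant_cube (n := n) a ha0 ha1
  refine ⟨(D ^ ∑ k, (rinv k - pinv k)) ^ s, ?_, ?_, fun w hw hw1 hwC f hf hfw => ?_⟩
  · have := zero_lt_one.trans_le hD1
    exact ENNReal.rpow_pos (ENNReal.rpow_pos this hDt)
      (ENNReal.rpow_ne_top_of_ne_zero this.ne' hDt)
  · exact (ENNReal.rpow_ne_top_of_nonneg (by linarith) (ENNReal.rpow_ne_top_of_nonneg
      (Finset.sum_nonneg fun k _ => (hτ k).le) hDt)).lt_top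
  set F : Fin (m + 1) → (Fin n → ℝ) → ℝ≥0∞ := fun k x => ENNReal.ofReal |f k x * w k x| with hF
  have hFm : ∀ k, Measurable (F k) := fun k =>
    ((hf k).mul (hw k).1).abs.ennreal_ofReal
  have hFn : ∀ k, wnorm (pinv k) (f k) (w k) = powNorm (pinv k) (F k) volume := fun k =>
    wnorm_eq_powNorm (hp0 k) _ _
  obtain ⟨G₀, hG₀m, hG₀0, hG₀int, hG₀⟩ := exists_majorant_normalized I
    (fun k hk => (hq0 k).trans_lt (sub_pos.1 (Finset.mem_filter.1 hk).2)) hFm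
  obtain ⟨G, hGm, hG0, hGG₀, hGint, hGD⟩ := hD
    (fun k => dualWeight (rinv k - pinv k) (w k)) (fun k => measurable_dualWeight (hw k))
    (fun k => dualWeight_ne_zero (hw k)) (fun k => dualWeight_ne_top (hw k))
    (fun k Q hQ => setLIntegral_dualWeight_ne_top hpr hw hwC hQ k) G₀ hG₀m hG₀0
    (ne_top_of_le_ne_top (by finiteness) hG₀int)
  have hGB : ∫⁻ x, ENNReal.ofReal (G x) ≤ 2 ^ m ^ 2 :=
    hGint.trans ((mul_le_mul_right hG₀int _).trans
      (three_halves_mul_add_le_two_pow_sq hIcard hm))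
  refine ⟨fun k x => w k x * G x ^ (qinv k - pinv k), fun k => ⟨?_, fun x => ?_⟩, fun x => ?_,
    ?_, ?_⟩
  · exact (hw k).1.mul (hGm.pow_const _)
  · exact mul_pos ((hw k).2 x) (Real.rpow_pos_of_pos (hG0 x) _)
  · rw [Finset.prod_mul_distrib, hw1, one_mul, ← Real.rpow_sum_of_pos (hG0 x),
      Finset.sum_sub_distrib, hpsum, hqsum, sub_self, Real.rpow_zero]
  · have h := prod_powNorm_le_mul_prod hp0 hq0 hqsum hFm
      (fun k => hFn k ▸ (hfw k).ne) hGm.ennreal_ofReal (fun x => by simpa using hG0 x)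
      (fun x => ofReal_ne_top) (fun k hk => by
        filter_upwards [hGG₀] with x hx
        exact (hG₀ k (by simpa [hIdef] using hk) x).trans hx)
      (one_le_pow_of_one_le' (by norm_num) _) hGB
    simp_rw [hFn]
    refine le_trans (Finset.prod_le_prod' fun k _ => ?_) h
    rw [wnorm_eq_powNorm (hq0 k)]
    refine powNorm_mono_ae (hq0 k) (Filter.Eventually.of_forall fun x => le_of_eq ?_)
    rw [ENNReal.ofReal_rpow_of_pos (hG0 x), ← ENNReal.ofReal_mul (abs_nonneg _), ← mul_assoc,
      abs_mul (f k x * w k x), abs_of_pos (Real.rpow_pos_of_pos (hG0 x) _)]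
  · have h := wConstS_mul_rpow_le hpr hqr hsum hγ hγ0 hΔ (fun k => rfl) hw hw1 hGm hG0 hGD
    rwa [add_sub_cancel] at h

end Paper
end
end

section
/- Equivalence of strong-type maximal bounds and sparse form bounds: Let r_1,…,r_{m+1} ∈ (0,∞) and p_1,…,p_{m+1} ∈ (0,∞] with 1/p_j < 1/r_j for all j and Σ_{j=1}^{m+1} 1/p_j = 1, and let w_1,…,w_{m+1} be weights with ∏_{j=1}^{m+1} w_j = 1. Then ‖M_{(r_1,…,r_{m+1})}‖_{L^{p_1}(w_1^{p_1})×⋯×L^{p_{m+1}}(w_{m+1}^{p_{m+1}}) → L^1} ≍ sup over all sparse collections S (with sparsity constant 2) of the smallest constant C with Λ_{(r_1,…,r_{m+1}),S}(f_1,…,f_{m+1}) ≤ C ∏_{j=1}^{m+1} ‖f_j‖_{L^{p_j}(w_j^{p_j})}, where the implicit constants depend only on the dimension n. In particular, the maximal operator maps L^{p_1}(w_1^{p_1})×⋯×L^{p_{m+1}}(w_{m+1}^{p_{m+1}}) boundedly into L^1 if and only if the sparse forms Λ_{(r_1,…,r_{m+1}),S} are uniformly bounded on L^{p_1}(w_1^{p_1})×⋯×L^{p_{m+1}}(w_{m+1}^{p_{m+1}}).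 -/
open MeasureTheory ENNReal

noncomputable section

namespace Paper

lemma measurable_finset_sup {α β ι : Type*} [MeasurableSpace α] [MeasurableSpace β]
    [SemilatticeSup β] [OrderBot β] [MeasurableSup₂ β] {f : ι → α → β} (s : Finset ι)
    (hf : ∀ i ∈ s, Measurable (f i)) : Measurable fun x => s.sup fun i => f i x := by
  have h : Measurable (s.sup f) :=
    Finset.sup_induction measurable_const (fun _ h₁ _ h₂ => h₁.sup h₂) hf
  convert h using 2 with x
  exact (Finset.sup_apply s f x).symm

lemma IsCube.measurableSet {n : ℕ} {Q : Set (Fin n → ℝ)} (hQ : IsCube Q) :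
    MeasurableSet Q := by
  obtain ⟨c, h, _, rfl⟩ := hQ
  exact MeasurableSet.univ_pi fun _ => measurableSet_Ico

lemma volume_cube {n : ℕ} (c : Fin n → ℝ) {h : ℝ} (hh : 0 ≤ h) :
    volume (Set.univ.pi fun i => Set.Ico (c i) (c i + h)) = ENNReal.ofReal (h ^ n) := by
  rw [Real.volume_pi_Ico]
  simp [ENNReal.ofReal_pow hh]

lemma IsCube.volume_pos {n : ℕ} {Q : Set (Fin n → ℝ)} (hQ : IsCube Q) : 0 < volume Q := by
  obtain ⟨c, h, hh, rfl⟩ := hQ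
  rw [volume_cube c hh.le]
  exact ENNReal.ofReal_pos.2 (pow_pos hh n)

lemma IsCube.volume_lt_top {n : ℕ} {Q : Set (Fin n → ℝ)} (hQ : IsCube Q) : volume Q < ∞ := by
  obtain ⟨c, h, hh, rfl⟩ := hQ
  rw [volume_cube c hh.le]
  exact ENNReal.ofReal_lt_top

/-- Vitali covering lemma for finite families of cubes. -/
lemma exists_disjoint_subfamily_volume_le {n : ℕ} (G : Finset (Set (Fin n → ℝ)))
    (hG : ∀ Q ∈ G, IsCube Q) :
    ∃ D ⊆ G, (D : Set (Set (Fin n → ℝ))).PairwiseDisjoint id ∧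
      volume (⋃ Q ∈ G, Q) ≤ 5 ^ n * ∑ Q ∈ D, volume Q := by
  classical
  choose! c h hpos heq using hG
  obtain ⟨u, hu, hdisj, hcov⟩ := Vitali.exists_disjoint_subfamily_covering_enlargement
    (id : Set (Fin n → ℝ) → Set (Fin n → ℝ)) (G : Set (Set (Fin n → ℝ))) h 2 one_lt_two
    (fun Q hQ => (hpos Q hQ).le) (∑ Q ∈ G, h Q)
    (fun Q hQ => Finset.single_le_sum (fun P hP => (hpos P hP).le) hQ)
    (fun Q hQ => by
      have hc : c Q ∈ Set.univ.pi fun i => Set.Ico (c Q i) (c Q i + h Q) := by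
        intro i _
        exact ⟨le_rfl, by linarith [hpos Q hQ]⟩
      rw [← heq Q hQ] at hc
      exact ⟨c Q, hc⟩)
  have hfin : u.Finite := G.finite_toSet.subset hu
  refine ⟨hfin.toFinset, fun Q hQ => hu (hfin.mem_toFinset.1 hQ), by simpa using hdisj, ?_⟩
  have hsub : (⋃ Q ∈ G, Q) ⊆
      ⋃ P ∈ hfin.toFinset, Metric.closedBall (fun i => c P i + h P / 2) (5 / 2 * h P) := by
    intro z hz
    simp only [Set.mem_iUnion, exists_prop] at hz ⊢
    obtain ⟨Q, hQ, hzQ⟩ := hz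
    obtain ⟨P, hP, ⟨y, hyQ, hyP⟩, hle⟩ := hcov Q hQ
    have hPG : P ∈ G := hu hP
    refine ⟨P, hfin.mem_toFinset.2 hP, ?_⟩
    have hk := hpos P hPG
    rw [Metric.mem_closedBall, dist_pi_le_iff (by linarith)]
    intro i
    rw [id, heq Q hQ] at hyQ
    rw [heq Q hQ] at hzQ
    rw [id, heq P hPG] at hyP
    have h1 := hyQ i trivial
    have h2 := hzQ i trivial
    have h3 := hyP i trivial
    simp only [Set.mem_Ico] at h1 h2 h3
    rw [Real.dist_eq, abs_le]
    constructor <;> linarith [h1.1, h1.2, h2.1, h2.2, h3.1, h3.2]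
  refine (measure_mono hsub).trans ((measure_biUnion_finset_le _ _).trans ?_)
  rw [Finset.mul_sum]
  refine Finset.sum_le_sum fun P hP => ?_
  have hPG : P ∈ G := hu (hfin.mem_toFinset.1 hP)
  have hk := hpos P hPG
  rw [Real.volume_pi_closedBall _ (by linarith)]
  conv_rhs => rw [heq P hPG, volume_cube _ hk.le]
  rw [Fintype.card_fin, show 2 * (5 / 2 * h P) = 5 * h P by ring, mul_pow,
    ENNReal.ofReal_mul (by positivity), ENNReal.ofReal_pow (by norm_num)]
  simp

/-- If every cube of a finite family is at least half covered by `U`, then the union of the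
family has measure controlled by that of `U`. -/
lemma volume_biUnion_le_of_half_covered {n : ℕ} (G : Finset (Set (Fin n → ℝ)))
    (hG : ∀ Q ∈ G, IsCube Q) (U : Set (Fin n → ℝ))
    (hU : ∀ Q ∈ G, volume Q ≤ 2 * volume (Q ∩ U)) :
    volume (⋃ Q ∈ G, Q) ≤ 5 ^ n * (2 * volume U) := by
  obtain ⟨D, hDG, hdisj, hle⟩ := exists_disjoint_subfamily_volume_le G hG
  refine hle.trans ?_
  gcongr
  calc ∑ Q ∈ D, volume Q ≤ ∑ Q ∈ D, 2 * volume (Q ∩ U) :=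
        Finset.sum_le_sum fun Q hQ => hU Q (hDG hQ)
    _ = 2 * ∑ Q ∈ D, volume.restrict U Q := by
        rw [Finset.mul_sum]
        refine Finset.sum_congr rfl fun Q hQ => ?_
        rw [Measure.restrict_apply (hG Q (hDG hQ)).measurableSet]
    _ = 2 * volume.restrict U (⋃ Q ∈ D, Q) := by
        rw [← measure_biUnion_finset (f := fun Q => Q) hdisj
          fun Q hQ => (hG Q (hDG hQ)).measurableSet]
    _ ≤ 2 * volume U := by
        gcongr 2 * ?_
        exact (measure_mono (Set.subset_univ _)).trans_eq (Measure.restrict_apply_univ U)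

/-- Greedy selection of a sparse subfamily `S` of a finite family of cubes, in order of
decreasing `a`. -/
lemma exists_sparse_subfamily {n : ℕ} {α : Type*} [LinearOrder α]
    (a : Set (Fin n → ℝ) → α) (F : Finset (Set (Fin n → ℝ))) (hF : ∀ Q ∈ F, IsCube Q) :
    ∃ S : SparseFamily n, ∃ T : Finset (Set (Fin n → ℝ)), S.cubes = T ∧ T ⊆ F ∧
      ∀ Q ∈ F, volume Q ≤ 2 * volume (Q ∩ ⋃ P ∈ T.filter fun P => a Q ≤ a P, P) := by
  classical
  induction F using Finset.induction_on_min_value a with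
  | empty =>
    exact ⟨⟨∅, id, by simp, by simp, by simp, by simp, by simp⟩, ∅, by simp, by simp, by simp⟩
  | insert Q F hQF hmin ih =>
    obtain ⟨S, T, hST, hTF, hcov⟩ := ih fun P hP => hF P (Finset.mem_insert_of_mem hP)
    have hQ : IsCube Q := hF Q (Finset.mem_insert_self _ _)
    have hfilter : (T.filter fun P => a Q ≤ a P) = T :=
      Finset.filter_true_of_mem fun P hP => hmin P (hTF hP)
    by_cases hhalf : volume Q ≤ 2 * volume (Q ∩ ⋃ P ∈ T, P)
    · refine ⟨S, T, hST, hTF.trans (Finset.subset_insert _ _), fun P hP => ?_⟩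
      rcases Finset.mem_insert.1 hP with rfl | hP
      · rwa [hfilter]
      · exact hcov P hP
    · have hQT : Q ∉ T := fun h => hQF (hTF h)
      have hmT : ∀ P ∈ T, P ∈ S.cubes := fun P hP => by rw [hST]; exact hP
      have hU : MeasurableSet (⋃ P ∈ T, P) :=
        T.measurableSet_biUnion fun P hP => (S.isCube P (hmT P hP)).measurableSet
      have hne : ∀ P ∈ T, P ≠ Q := fun P hP h => hQT (h ▸ hP)
      have hdisj : ∀ P ∈ T, Disjoint (S.E P) (Q \ ⋃ P ∈ T, P) := fun P hP =>
        Set.disjoint_left.2 fun x hx hx' =>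
          hx'.2 (Set.mem_biUnion hP (S.E_subset P (hmT P hP) hx))
      refine ⟨⟨(insert Q T : Finset _), Function.update S.E Q (Q \ ⋃ P ∈ T, P), ?_, ?_, ?_, ?_, ?_⟩,
        insert Q T, rfl, Finset.insert_subset_insert _ hTF, ?_⟩
      · exact fun P hP => hF P (Finset.insert_subset_insert _ hTF hP)
      · intro P hP
        rcases Finset.mem_insert.1 hP with rfl | hP
        · simp
        · rw [Function.update_of_ne (hne P hP)]
          exact S.E_subset P (hmT P hP)
      · intro P hP
        rcases Finset.mem_insert.1 hP with rfl | hP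
        · simpa using hQ.measurableSet.diff hU
        · rw [Function.update_of_ne (hne P hP)]
          exact S.E_meas P (hmT P hP)
      · intro P hP P' hP' hPP'
        rcases Finset.mem_insert.1 hP with rfl | hP <;>
          rcases Finset.mem_insert.1 hP' with hP'Q | hP'
        · exact absurd hP'Q.symm hPP'
        · rw [Function.update_of_ne (hne P' hP'), Function.update_self]
          exact (hdisj P' hP').symm
        · rw [hP'Q, Function.update_of_ne (hne P hP), Function.update_self]
          exact hdisj P hP
        · rw [Function.update_of_ne (hne P hP), Function.update_of_ne (hne P' hP')]
          exact S.E_disj P (hmT P hP) P' (hmT P' hP') hPP'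
      · intro P hP
        rcases Finset.mem_insert.1 hP with rfl | hP
        · rw [Function.update_self]
          push Not at hhalf
          have hsplit := measure_inter_add_sdiff (μ := volume) P hU
          have hfin := hQ.volume_lt_top
          have h1 : volume (P ∩ ⋃ P ∈ T, P) ≠ ∞ :=
            ((measure_mono Set.inter_subset_left).trans_lt hfin).ne
          have h2 : volume (P \ ⋃ P ∈ T, P) ≠ ∞ :=
            ((measure_mono Set.sdiff_subset).trans_lt hfin).ne
          rw [← hsplit, two_mul] at hhalf
          have h3 := (ENNReal.add_lt_add_iff_left h1).1 hhalf
          rw [← hsplit, two_mul]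
          gcongr
        · rw [Function.update_of_ne (hne P hP)]
          exact S.density P (hmT P hP)
      · intro P hP
        rcases Finset.mem_insert.1 hP with rfl | hP
        · have hsub : P ⊆ ⋃ R ∈ (insert P T).filter fun R => a P ≤ a R, R :=
            Set.subset_biUnion_of_mem (u := fun R => R)
              (show P ∈ ((insert P T).filter fun R => a P ≤ a R) by simp)
          rw [Set.inter_eq_left.2 hsub, two_mul]
          exact le_self_add
        · refine (hcov P hP).trans ?_
          gcongr 2 * volume (_ ∩ ?_)
          exact Set.biUnion_subset_biUnion_left
            (Finset.filter_subset_filter _ (Finset.subset_insert _ _))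

/-- The sum over a sparse family dominates, for an arbitrary set function `b`, the integral of
the maximal function of `b` over a finite family of cubes. -/
lemma exists_sparse_lintegral_sup_le_nnreal {n : ℕ} (b : Set (Fin n → ℝ) → NNReal)
    (F : Finset (Set (Fin n → ℝ))) (hF : ∀ Q ∈ F, IsCube Q) :
    ∃ S : SparseFamily n,
      ∫⁻ x, ((F.sup fun Q => Q.indicator (fun _ => b Q) x : NNReal) : ℝ≥0∞) ≤
        5 ^ n * 2 * ∑' Q : S.cubes, (b Q.1 : ℝ≥0∞) * volume Q.1 := by
  classical
  obtain ⟨S, T, hST, hTF, hcov⟩ := exists_sparse_subfamily b F hF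
  refine ⟨S, ?_⟩
  have hmeas : Measurable fun x => F.sup fun Q => Q.indicator (fun _ => b Q) x :=
    measurable_finset_sup F fun Q hQ => measurable_const.indicator (hF Q hQ).measurableSet
  have hsum : ∑' Q : S.cubes, (b Q.1 : ℝ≥0∞) * volume Q.1 = ∑ Q ∈ T, (b Q : ℝ≥0∞) * volume Q := by
    rw [hST]
    exact Finset.tsum_subtype T fun Q => (b Q : ℝ≥0∞) * volume Q
  have hcake := lintegral_eq_lintegral_meas_lt (volume : Measure (Fin n → ℝ))
    (f := fun x => ((F.sup fun Q => Q.indicator (fun _ => b Q) x : NNReal) : ℝ))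
    (Filter.Eventually.of_forall fun _ => NNReal.coe_nonneg _) hmeas.coe_nnreal_real.aemeasurable
  simp only [ENNReal.ofReal_coe_nnreal] at hcake
  rw [hcake, hsum]
  have hlevel : ∀ t ∈ Set.Ioi (0 : ℝ),
      volume {x | t < ((F.sup fun Q => Q.indicator (fun _ => b Q) x : NNReal) : ℝ)} ≤
        5 ^ n * 2 * ∑ P ∈ T, (Set.Iio (b P : ℝ)).indicator (fun _ => volume P) t := by
    intro t ht
    lift t to NNReal using le_of_lt ht
    have hset : {x | (t : ℝ) < ((F.sup fun Q => Q.indicator (fun _ => b Q) x : NNReal) : ℝ)} ⊆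
        ⋃ Q ∈ F.filter fun Q => t < b Q, Q := by
      intro x hx
      rw [Set.mem_ofPred_eq, NNReal.coe_lt_coe, Finset.lt_sup_iff] at hx
      obtain ⟨Q, hQ, hlt⟩ := hx
      have hxQ : x ∈ Q := by
        by_contra hxQ
        simp [Set.indicator_of_notMem hxQ] at hlt
      rw [Set.indicator_of_mem hxQ] at hlt
      exact Set.mem_biUnion (by simp [hQ, hlt]) hxQ
    have hU := volume_biUnion_le_of_half_covered (F.filter fun Q => t < b Q)
      (fun Q hQ => hF Q (Finset.mem_filter.1 hQ).1) (⋃ P ∈ T.filter fun P => t < b P, P)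
      (fun Q hQ => by
        obtain ⟨hQF, hQt⟩ := Finset.mem_filter.1 hQ
        refine (hcov Q hQF).trans ?_
        gcongr 2 * volume (_ ∩ ?_)
        refine Set.biUnion_subset_biUnion_left fun P hP => ?_
        obtain ⟨hPT, hle⟩ := Finset.mem_filter.1 hP
        exact Finset.mem_filter.2 ⟨hPT, hQt.trans_le hle⟩)
    refine (measure_mono hset).trans (hU.trans ?_)
    rw [mul_assoc]
    gcongr
    refine (measure_biUnion_finset_le _ _).trans ?_
    rw [Finset.sum_filter]
    refine Finset.sum_le_sum fun P _ => ?_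
    by_cases h : t < b P
    · simp [h]
    · simp [h]
  refine (setLIntegral_mono' measurableSet_Ioi hlevel).trans ?_
  have hind : ∀ P : Set (Fin n → ℝ),
      Measurable ((Set.Iio (b P : ℝ)).indicator fun _ => volume P) :=
    fun P => measurable_const.indicator measurableSet_Iio
  rw [lintegral_const_mul _ (Finset.measurable_fun_sum _ fun P _ => hind P),
    lintegral_finsetSum _ fun P _ => hind P]
  gcongr with P hP
  rw [lintegral_indicator_const measurableSet_Iio, Measure.restrict_apply measurableSet_Iio,
    Set.Iio_inter_Ioi, Real.volume_Ioo, mul_comm]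
  simp

lemma lintegral_sup_le_of_sparse_le {n : ℕ} (a : Set (Fin n → ℝ) → ℝ≥0∞) (K : ℝ≥0∞)
    (hK : ∀ S : SparseFamily n, ∑' Q : S.cubes, a Q.1 * volume Q.1 ≤ K)
    (F : Finset (Set (Fin n → ℝ))) (hF : ∀ Q ∈ F, IsCube Q) :
    ∫⁻ x, (F.sup fun Q => Q.indicator (fun _ => a Q) x) ≤ 5 ^ n * 2 * K := by
  classical
  by_cases hKtop : K = ∞
  · rw [hKtop, ENNReal.mul_top (by positivity)]
    exact le_top
  have hfin : ∀ Q ∈ F, a Q ≠ ∞ := by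
    intro Q hQ hQa
    have hcube := hF Q hQ
    have h := hK ⟨{Q}, id, by simpa using hcube, by simp, by simpa using hcube.measurableSet,
      by simp +contextual, by simp [two_mul]⟩
    simp only [tsum_singleton Q fun Q => a Q * volume Q, hQa,
      ENNReal.top_mul hcube.volume_pos.ne', top_le_iff] at h
    exact hKtop h
  obtain ⟨S, hS⟩ := exists_sparse_lintegral_sup_le_nnreal (fun Q => (a Q).toNNReal) F hF
  refine le_trans (lintegral_mono fun x => ?_) (hS.trans ?_)
  · refine Finset.sup_le fun Q hQ => ?_
    by_cases hx : x ∈ Q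
    · rw [Set.indicator_of_mem hx, ← ENNReal.coe_toNNReal (hfin Q hQ), ENNReal.coe_le_coe]
      have := Finset.le_sup (f := fun Q => Q.indicator (fun _ => (a Q).toNNReal) x) hQ
      rwa [Set.indicator_of_mem hx] at this
    · simp [Set.indicator_of_notMem hx]
  · gcongr
    refine le_trans (ENNReal.tsum_le_tsum fun Q => ?_) (hK S)
    gcongr
    exact ENNReal.coe_toNNReal_le_self

lemma lintegral_iSup_le_of_sparse_le {n : ℕ} (a : Set (Fin n → ℝ) → ℝ≥0∞) (K : ℝ≥0∞)
    (hK : ∀ S : SparseFamily n, ∑' Q : S.cubes, a Q.1 * volume Q.1 ≤ K)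
    (q : ℕ → Set (Fin n → ℝ)) (hq : ∀ k, IsCube (q k)) :
    ∫⁻ x, (⨆ k, (q k).indicator (fun _ => a (q k)) x) ≤ 5 ^ n * 2 * K := by
  classical
  let g : ℕ → (Fin n → ℝ) → ℝ≥0∞ := fun N x =>
    ((Finset.range N).image q).sup fun Q => Q.indicator (fun _ => a Q) x
  have hcube : ∀ N, ∀ Q ∈ (Finset.range N).image q, IsCube Q := by
    intro N Q hQ
    obtain ⟨k, _, rfl⟩ := Finset.mem_image.1 hQ
    exact hq k
  have hg : ∀ N, Measurable (g N) := fun N =>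
    measurable_finset_sup _ fun Q hQ =>
      measurable_const.indicator (hcube N Q hQ).measurableSet
  have hmono : Monotone g := fun N N' hN x =>
    Finset.sup_mono (Finset.image_subset_image (Finset.range_subset_range.2 hN))
  calc ∫⁻ x, (⨆ k, (q k).indicator (fun _ => a (q k)) x) ≤ ∫⁻ x, ⨆ N, g N x := by
        refine lintegral_mono fun x => iSup_le fun k => le_iSup_of_le (k + 1) ?_
        exact Finset.le_sup (f := fun Q => Q.indicator (fun _ => a Q) x)
          (Finset.mem_image_of_mem q (Finset.self_mem_range_succ k))
    _ = ⨆ N, ∫⁻ x, g N x := lintegral_iSup hg hmono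
    _ ≤ 5 ^ n * 2 * K := iSup_le fun N =>
        lintegral_sup_le_of_sparse_le a K hK _ (hcube N)

/-- A countable family of cubes approximating every cube from outside. -/
lemma exists_countable_cubes (n : ℕ) :
    ∃ q : ℕ → Set (Fin n → ℝ), (∀ k, IsCube (q k)) ∧
      ∀ Q, IsCube Q → ∀ r : ℝ, 1 < r →
        ∃ k, Q ⊆ q k ∧ volume (q k) ≤ ENNReal.ofReal (r ^ n) * volume Q := by
  let I := (Fin n → ℚ) × {h : ℚ // 0 < h}
  have : Nonempty I := ⟨(0, ⟨1, one_pos⟩)⟩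
  obtain ⟨e, he⟩ := exists_surjective_nat I
  refine ⟨fun k => Set.univ.pi fun i =>
    Set.Ico (((e k).1 i : ℚ) : ℝ) (((e k).1 i : ℚ) + (((e k).2 : ℚ) : ℝ)), fun k =>
    ⟨fun i => ((e k).1 i : ℝ), _, by exact_mod_cast (e k).2.2, rfl⟩, ?_⟩
  rintro _ ⟨c, h, hh, rfl⟩ r hr
  have hd : 0 < h * (r - 1) := mul_pos hh (by linarith)
  choose c' hc' using fun i =>
    exists_rat_btwn (show c i - h * (r - 1) / 2 < c i by linarith)
  obtain ⟨h', hh'⟩ := exists_rat_btwn (show h + h * (r - 1) / 2 < h * r by nlinarith)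
  have hh'pos : (0 : ℝ) < h' := by linarith [hh'.1]
  obtain ⟨k, hk⟩ := he (c', ⟨h', by exact_mod_cast hh'pos⟩)
  refine ⟨k, ?_, ?_⟩
  · simp only [hk]
    intro x hx i _
    have := hx i trivial
    simp only [Set.mem_Ico] at this ⊢
    constructor <;> linarith [hc' i, (hc' i).1, (hc' i).2, hh'.1, this.1, this.2]
  · simp only [hk]
    rw [volume_cube c hh.le, volume_cube (fun i => (c' i : ℝ)) hh'pos.le,
      ← ENNReal.ofReal_mul (by positivity), ← mul_pow, mul_comm r h]
    gcongr
    exact hh'.2.le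

lemma avg_le_of_subset {n : ℕ} {τ : ℝ} (hτ : 0 < τ) (f : (Fin n → ℝ) → ℝ)
    {Q Q' : Set (Fin n → ℝ)} (hQ' : IsCube Q') (hsub : Q ⊆ Q') {ρ : ℝ≥0∞}
    (hvol : volume Q' ≤ ρ * volume Q) :
    avg τ f Q ≤ ρ ^ τ * avg τ f Q' := by
  rw [avg, avg, if_neg hτ.ne', if_neg hτ.ne', ← ENNReal.mul_rpow_of_nonneg _ _ hτ.le, ← mul_assoc]
  gcongr
  rw [← div_eq_mul_inv, ENNReal.le_div_iff_mul_le (Or.inl hQ'.volume_pos.ne')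
    (Or.inl hQ'.volume_lt_top.ne), mul_comm, ← div_eq_mul_inv]
  exact ENNReal.div_le_of_le_mul hvol

lemma exists_one_lt_pow_rpow_le_two (n : ℕ) {σ : ℝ} (hσ : 0 ≤ σ) :
    ∃ r : ℝ, 1 < r ∧ (r ^ n) ^ σ ≤ 2 := by
  have h : 0 < n * σ + 1 := by positivity
  refine ⟨2 ^ (1 / (n * σ + 1)), Real.one_lt_rpow one_lt_two (by positivity), ?_⟩
  rw [← Real.rpow_mul_natCast zero_le_two, ← Real.rpow_mul zero_le_two]
  refine (Real.rpow_le_rpow_of_exponent_le one_le_two ?_).trans_eq (Real.rpow_one 2)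
  rw [mul_assoc, one_div, inv_mul_le_iff₀ h]
  linarith

/-- Sparse form bounds for `f` imply the `L¹` bound for the maximal function of `f`. -/
lemma lintegral_maximal_le_of_sparseForm_le {n m : ℕ} (rinv : Fin m → ℝ) (hr : ∀ j, 0 < rinv j)
    (f : Fin m → (Fin n → ℝ) → ℝ) (K : ℝ≥0∞)
    (hK : ∀ S : SparseFamily n, sparseForm rinv S f ≤ K) :
    ∫⁻ x, maximal rinv f x ≤ 4 * 5 ^ n * K := by
  obtain ⟨q, hq, happrox⟩ := exists_countable_cubes n
  obtain ⟨r, hr1, hr2⟩ := exists_one_lt_pow_rpow_le_two n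
    (Finset.sum_nonneg fun j (_ : j ∈ Finset.univ) => (hr j).le)
  have hrpos : 0 < r ^ n := by positivity
  have hprod : ∏ j, ENNReal.ofReal (r ^ n) ^ rinv j ≤ 2 := by
    simp only [ENNReal.ofReal_rpow_of_pos hrpos]
    rw [← ENNReal.ofReal_prod_of_nonneg fun j _ => by positivity,
      ← Real.rpow_sum_of_pos hrpos]
    exact (ENNReal.ofReal_le_ofReal hr2).trans (by simp)
  let a : Set (Fin n → ℝ) → ℝ≥0∞ := fun Q => ∏ j, avg (rinv j) (f j) Q
  have hpt : ∀ x, maximal rinv f x ≤ 2 * ⨆ k, (q k).indicator (fun _ => a (q k)) x := by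
    intro x
    refine iSup_le fun ⟨Q, hQ, hx⟩ => ?_
    obtain ⟨k, hsub, hvol⟩ := happrox Q hQ r hr1
    calc ∏ j, avg (rinv j) (f j) Q
        ≤ ∏ j, (ENNReal.ofReal (r ^ n) ^ rinv j * avg (rinv j) (f j) (q k)) :=
          Finset.prod_le_prod' fun j _ => avg_le_of_subset (hr j) (f j) (hq k) hsub hvol
      _ ≤ 2 * a (q k) := by
          rw [Finset.prod_mul_distrib]
          gcongr
      _ ≤ 2 * ⨆ k, (q k).indicator (fun _ => a (q k)) x := by
          gcongr
          refine le_iSup_of_le k ?_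
          rw [Set.indicator_of_mem (hsub hx)]
  calc ∫⁻ x, maximal rinv f x
      ≤ ∫⁻ x, 2 * ⨆ k, (q k).indicator (fun _ => a (q k)) x := lintegral_mono hpt
    _ = 2 * ∫⁻ x, ⨆ k, (q k).indicator (fun _ => a (q k)) x :=
        lintegral_const_mul' _ _ ENNReal.ofNat_ne_top
    _ ≤ 2 * (5 ^ n * 2 * K) := by
        gcongr
        exact lintegral_iSup_le_of_sparse_le a K hK q hq
    _ = 4 * 5 ^ n * K := by ring

/-- Every sparse form is dominated by the `L¹` norm of the maximal function. -/
lemma sparseForm_le_lintegral_maximal {n m : ℕ} (rinv : Fin m → ℝ) (S : SparseFamily n)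
    (f : Fin m → (Fin n → ℝ) → ℝ) :
    sparseForm rinv S f ≤ 2 * ∫⁻ x, maximal rinv f x := by
  rw [sparseForm, ENNReal.tsum_eq_iSup_sum]
  refine iSup_le fun T => ?_
  calc ∑ Q ∈ T, (∏ j, avg (rinv j) (f j) Q.1) * volume Q.1
      ≤ ∑ Q ∈ T, 2 * ∫⁻ x in S.E Q.1, maximal rinv f x := by
        refine Finset.sum_le_sum fun Q _ => ?_
        calc (∏ j, avg (rinv j) (f j) Q.1) * volume Q.1
            ≤ (∏ j, avg (rinv j) (f j) Q.1) * (2 * volume (S.E Q.1)) := by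
              gcongr
              exact S.density Q.1 Q.2
          _ = 2 * ∫⁻ _ in S.E Q.1, ∏ j, avg (rinv j) (f j) Q.1 := by
              rw [setLIntegral_const]
              ring
          _ ≤ 2 * ∫⁻ x in S.E Q.1, maximal rinv f x := by
              gcongr 2 * ?_
              refine setLIntegral_mono' (S.E_meas Q.1 Q.2) fun x hx => ?_
              exact le_iSup (fun P : {P : Set (Fin n → ℝ) // IsCube P ∧ x ∈ P} =>
                ∏ j, avg (rinv j) (f j) P.1)
                ⟨Q.1, S.isCube Q.1 Q.2, S.E_subset Q.1 Q.2 hx⟩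
    _ = 2 * ∫⁻ x in ⋃ Q ∈ T, S.E Q.1, maximal rinv f x := by
        rw [← Finset.mul_sum, lintegral_biUnion_finset]
        · exact fun Q _ P _ hQP =>
            S.E_disj Q.1 Q.2 P.1 P.2 fun h => hQP (Subtype.ext h)
        · exact fun Q _ => S.E_meas Q.1 Q.2
    _ ≤ 2 * ∫⁻ x, maximal rinv f x := by
        gcongr 2 * ?_
        exact setLIntegral_le_lintegral _ _

/-- **Equivalence of strong-type maximal bounds and sparse form bounds**
(part of Proposition 2.5): the `L¹` operator norm of `M_{r⃗}` on
`L^{p_1}(w_1^{p_1}) × ⋯ × L^{p_{m+1}}(w_{m+1}^{p_{m+1}})` is comparable, with dimensional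
constants, to the supremum over sparse collections (of sparsity constant 2) of the smallest
constant in the bound for the sparse form `Λ_{r⃗,S}`; in particular one boundedness holds
iff the other does. -/
theorem maximal_L1_iff_sparse_forms (n : ℕ) :
    ∃ C : ℝ≥0∞, 0 < C ∧ C < ∞ ∧
      ∀ (m : ℕ) (rinv pinv : Fin (m + 1) → ℝ),
        (∀ j, 0 < rinv j) → (∀ j, 0 ≤ pinv j) → (∀ j, pinv j < rinv j) →
        (∑ j, pinv j) = 1 →
        ∀ w : Fin (m + 1) → (Fin n → ℝ) → ℝ, (∀ j, IsWeight (w j)) →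
          (∀ x, ∏ j, w j x = 1) →
        (∀ B : ℝ≥0∞,
            (∀ (S : SparseFamily n) (f : Fin (m + 1) → (Fin n → ℝ) → ℝ),
              (∀ j, Measurable (f j)) →
              sparseForm rinv S f ≤ B * ∏ j, wnorm (pinv j) (f j) (w j)) →
            ∀ f : Fin (m + 1) → (Fin n → ℝ) → ℝ, (∀ j, Measurable (f j)) →
              (∫⁻ x, maximal rinv f x) ≤ C * B * ∏ j, wnorm (pinv j) (f j) (w j)) ∧
        (∀ B : ℝ≥0∞,
            (∀ f : Fin (m + 1) → (Fin n → ℝ) → ℝ, (∀ j, Measurable (f j)) →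
              (∫⁻ x, maximal rinv f x) ≤ B * ∏ j, wnorm (pinv j) (f j) (w j)) →
            ∀ (S : SparseFamily n) (f : Fin (m + 1) → (Fin n → ℝ) → ℝ),
              (∀ j, Measurable (f j)) →
              sparseForm rinv S f ≤ C * B * ∏ j, wnorm (pinv j) (f j) (w j)) ∧
        ((∃ B : ℝ≥0∞, B < ∞ ∧
            ∀ f : Fin (m + 1) → (Fin n → ℝ) → ℝ, (∀ j, Measurable (f j)) →
              (∫⁻ x, maximal rinv f x) ≤ B * ∏ j, wnorm (pinv j) (f j) (w j)) ↔
          (∃ B : ℝ≥0∞, B < ∞ ∧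
            ∀ (S : SparseFamily n) (f : Fin (m + 1) → (Fin n → ℝ) → ℝ),
              (∀ j, Measurable (f j)) →
              sparseForm rinv S f ≤ B * ∏ j, wnorm (pinv j) (f j) (w j))) := by
  have hC : (4 * 5 ^ n : ℝ≥0∞) < ∞ :=
    ENNReal.mul_lt_top ENNReal.ofNat_lt_top (ENNReal.pow_lt_top ENNReal.ofNat_lt_top)
  refine ⟨4 * 5 ^ n, by positivity, hC, ?_⟩
  intro m rinv pinv hr _ _ _ w _ _
  have h₁ : ∀ B : ℝ≥0∞,
      (∀ (S : SparseFamily n) (f : Fin (m + 1) → (Fin n → ℝ) → ℝ), (∀ j, Measurable (f j)) →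
        sparseForm rinv S f ≤ B * ∏ j, wnorm (pinv j) (f j) (w j)) →
      ∀ f : Fin (m + 1) → (Fin n → ℝ) → ℝ, (∀ j, Measurable (f j)) →
        (∫⁻ x, maximal rinv f x) ≤ 4 * 5 ^ n * B * ∏ j, wnorm (pinv j) (f j) (w j) := by
    intro B hB f hf
    rw [mul_assoc]
    exact lintegral_maximal_le_of_sparseForm_le rinv hr f _ fun S => hB S f hf
  have h₂ : ∀ B : ℝ≥0∞,
      (∀ f : Fin (m + 1) → (Fin n → ℝ) → ℝ, (∀ j, Measurable (f j)) →
        (∫⁻ x, maximal rinv f x) ≤ B * ∏ j, wnorm (pinv j) (f j) (w j)) →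
      ∀ (S : SparseFamily n) (f : Fin (m + 1) → (Fin n → ℝ) → ℝ), (∀ j, Measurable (f j)) →
        sparseForm rinv S f ≤ 4 * 5 ^ n * B * ∏ j, wnorm (pinv j) (f j) (w j) := by
    intro B hB S f hf
    have hC₂ : (2 : ℝ≥0∞) ≤ 4 * 5 ^ n :=
      calc (2 : ℝ≥0∞) ≤ 4 * 1 := by norm_num
        _ ≤ 4 * 5 ^ n := by
          gcongr
          exact one_le_pow₀ (by norm_num)
    rw [mul_assoc]
    exact (sparseForm_le_lintegral_maximal rinv S f).trans (mul_le_mul' hC₂ (hB f hf))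
  refine ⟨h₁, h₂, ?_, ?_⟩
  · rintro ⟨B, hB, h⟩
    exact ⟨_, ENNReal.mul_lt_top hC hB, h₂ B h⟩
  · rintro ⟨B, hB, h⟩
    exact ⟨_, ENNReal.mul_lt_top hC hB, h₁ B h⟩

end Paper
end
end
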